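/- arXiv:1110.5007 — 3 statements merged into one kernel-verified Lean document; each statement's English description precedes it below -/
import Mathlib

section
/- Let 3 ≤ k ≤ n−1, let v ∈ {1,...,n}, and let H be the k-uniform hypergraph on {1,...,n} whose hyperedges are all k-element subsets of {1,...,n} containing v (the k-uniform star hypergraph at v). Then the coloring complex Λ(H) is shellable (and pure of dimension n−k−1). -/
/-- The set of faces of the coloring complex `Λ(H)` of a hypergraph `H` (a set of
hyperedges, each a finset of vertices) on the vertex set `Fin n`.  A face is a chain
`S_1 ⊊ ⋯ ⊊ S_t` of nonempty proper subsets of the vertex set (corresponding to the ordered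
set partition with blocks `S_1, S_2 \ S_1, …, V \ S_t`) such that at least one of these
blocks contains a hyperedge; the block below `S ∈ F ∪ {V}` is `S` minus the union of the
members of `F` strictly contained in `S`. -/
def lamFaces (n : ℕ) (H : Finset (Finset (Fin n))) : Set (Finset (Finset (Fin n))) :=
  {F | (∀ S ∈ F, S.Nonempty ∧ S ≠ Finset.univ) ∧
    (∀ S ∈ F, ∀ T ∈ F, S ⊆ T ∨ T ⊆ S) ∧
    (∃ e ∈ H, ∃ S ∈ insert Finset.univ F, e ⊆ S \ (F.filter (· ⊂ S)).sup id)}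

/-- `F` is a facet (maximal face) of the complex `K`. -/
def IsFacetIn {α : Type} (K : Set (Finset α)) (F : Finset α) : Prop :=
  F ∈ K ∧ ∀ G ∈ K, F ⊆ G → F = G

/-- A complex `K` (given as its set of faces, each face being the finset of its vertices;
an `r`-dimensional face has `r+1` elements) is shellable: its facets can be enumerated
`F_0, …, F_{N-1}` (without repetition) so that for each `l ≥ 1` the complex
`(⋃_{i<l} \bar F_i) ∩ \bar F_l` is nonempty and pure of dimension `dim F_l - 1`, i.e.
each of its maximal elements `G` satisfies `|G| = |F_l| - 1`. -/
def Shellable {α : Type} (K : Set (Finset α)) : Prop :=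
  ∃ (N : ℕ) (F : Fin N → Finset α),
    Function.Injective F ∧ (∀ i, IsFacetIn K (F i)) ∧ (∀ G, IsFacetIn K G → ∃ i, F i = G) ∧
    ∀ l : Fin N, 0 < (l : ℕ) →
      (∃ G : Finset α, G ⊆ F l ∧ ∃ i : Fin N, (i : ℕ) < (l : ℕ) ∧ G ⊆ F i) ∧
      (∀ G : Finset α, (G ⊆ F l ∧ ∃ i : Fin N, (i : ℕ) < (l : ℕ) ∧ G ⊆ F i) →
        (∀ G' : Finset α, (G' ⊆ F l ∧ ∃ i : Fin N, (i : ℕ) < (l : ℕ) ∧ G' ⊆ F i) →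
          G ⊆ G' → G = G') →
        G.card + 1 = (F l).card)

/-- A complex over a finite vertex set is shellable as soon as some key on its facets has the
exchange property: a facet `G ≠ F` whose key is at most that of `F` misses an element `S` of `F`
such that `F \ {S}` lies in a facet of strictly smaller key. -/
theorem shellable_of_key {α β : Type} [Finite α] [DecidableEq α] [LinearOrder β]
    {K : Set (Finset α)} (key : Finset α → β)
    (h : ∀ F G, IsFacetIn K F → IsFacetIn K G → F ≠ G → key G ≤ key F →
      ∃ F', IsFacetIn K F' ∧ key F' < key F ∧ ∃ S ∈ F, S ∉ G ∧ F.erase S ⊆ F') :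
    Shellable K := by
  classical
  obtain ⟨N, ⟨e⟩⟩ := Finite.exists_equiv_fin {F // IsFacetIn K F}
  let F₀ : Fin N → Finset α := fun i => (e.symm i).1
  let s := Tuple.sort (key ∘ F₀)
  have hmono : Monotone ((key ∘ F₀) ∘ s) := Tuple.monotone_sort _
  have hfacet : ∀ i, IsFacetIn K (F₀ (s i)) := fun i => (e.symm (s i)).2
  have hinj : Function.Injective (F₀ ∘ s) :=
    (Subtype.val_injective.comp e.symm.injective).comp s.injective
  have hsurj : ∀ G, IsFacetIn K G → ∃ i, F₀ (s i) = G := fun G hG =>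
    ⟨s.symm (e ⟨G, hG⟩), by simp [F₀]⟩
  refine ⟨N, F₀ ∘ s, hinj, hfacet, hsurj, fun l hl => ⟨?_, ?_⟩⟩
  · exact ⟨∅, Finset.empty_subset _, ⟨0, hl.trans l.2⟩, hl, Finset.empty_subset _⟩
  · rintro G ⟨hGl, i, hil, hGi⟩ hmax
    have hne : F₀ (s l) ≠ F₀ (s i) := fun hEq => by
      have := hinj (a₁ := l) (a₂ := i) hEq
      subst this
      exact lt_irrefl _ hil
    obtain ⟨F', hF', hlt, S, hS, hSG, hsub⟩ :=
      h _ _ (hfacet l) (hfacet i) hne (hmono (Fin.le_def.2 hil.le))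
    obtain ⟨j, rfl⟩ := hsurj F' hF'
    have hjl : j < l := lt_of_not_ge fun hle => (hmono hle).not_gt hlt
    have hG : G = (F₀ (s l)).erase S := by
      refine hmax _ ⟨Finset.erase_subset _ _, j, hjl, hsub⟩ ?_
      exact Finset.subset_erase.2 ⟨hGl, fun hSG' => hSG (hGi hSG')⟩
    rw [hG]
    exact Finset.card_erase_add_one hS

section StarFaces

variable {n k : ℕ} {v : Fin n} {F G : Finset (Finset (Fin n))}

/-- A chain of nonempty proper subsets in which the block containing `v` has at least `k`
elements. -/
def IsStarFace (k : ℕ) (v : Fin n) (F : Finset (Finset (Fin n))) : Prop :=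
  (∀ S ∈ F, S.Nonempty ∧ S ≠ Finset.univ) ∧
    (∀ S ∈ F, ∀ T ∈ F, S ⊆ T ∨ T ⊆ S) ∧
    ∀ X ∈ insert ∅ F, ∀ Y ∈ insert Finset.univ F, v ∉ X → v ∈ Y → X.card + k ≤ Y.card

/-- The members of a chain that avoid `v` have a largest one, where `∅` stands in if there are
none. -/
theorem exists_greatest_notMem (hF : ∀ S ∈ F, ∀ T ∈ F, S ⊆ T ∨ T ⊆ S) :
    ∃ X ∈ insert ∅ F, v ∉ X ∧ ∀ T ∈ F, v ∉ T → T ⊆ X := by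
  obtain ⟨X, hX, hmax⟩ := Finset.exists_max_image ((insert ∅ F).filter (v ∉ ·)) Finset.card
    ⟨∅, by simp⟩
  rw [Finset.mem_filter] at hX
  refine ⟨X, hX.1, hX.2, fun T hT hvT => ?_⟩
  have hc := hmax T (Finset.mem_filter.2 ⟨Finset.mem_insert_of_mem hT, hvT⟩)
  rcases Finset.mem_insert.1 hX.1 with h | h
  · subst h
    simpa using hc
  · rcases hF T hT X h with h' | h'
    · exact h'
    · exact (Finset.eq_of_subset_of_card_le h' hc).symm.subset

/-- The members of a chain that contain `v` have a smallest one, where the whole vertex set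
stands in if there are none. -/
theorem exists_least_mem (hF : ∀ S ∈ F, ∀ T ∈ F, S ⊆ T ∨ T ⊆ S) :
    ∃ Y ∈ insert Finset.univ F, v ∈ Y ∧ ∀ T ∈ F, v ∈ T → Y ⊆ T := by
  obtain ⟨Y, hY, hmin⟩ := Finset.exists_min_image ((insert Finset.univ F).filter (v ∈ ·))
    Finset.card ⟨Finset.univ, by simp⟩
  rw [Finset.mem_filter] at hY
  refine ⟨Y, hY.1, hY.2, fun T hT hvT => ?_⟩
  have hc := hmin T (Finset.mem_filter.2 ⟨Finset.mem_insert_of_mem hT, hvT⟩)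
  rcases Finset.mem_insert.1 hY.1 with h | h
  · subst h
    exact (Finset.eq_of_subset_of_card_le (Finset.subset_univ T) hc).symm.subset
  · rcases hF T hT Y h with h' | h'
    · exact (Finset.eq_of_subset_of_card_le h' hc).symm.subset
    · exact h'

theorem mem_lamFaces_star (hk : 1 ≤ k) :
    F ∈ lamFaces n ((Finset.powersetCard k Finset.univ).filter (fun e => v ∈ e)) ↔
      IsStarFace k v F := by
  refine and_congr_right fun _ => and_congr_right fun hchain => ⟨?_, fun h => ?_⟩
  · rintro ⟨e, he, S, hS, heS⟩ X hX Y hY hvX hvY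
    rw [Finset.mem_filter, Finset.mem_powersetCard] at he
    obtain ⟨⟨-, hcard⟩, hve⟩ := he
    have hvS := Finset.mem_sdiff.1 (heS hve)
    have hbelow : ∀ T ∈ F, T ⊂ S → T ⊆ (F.filter (· ⊂ S)).sup id := fun T hT hTS =>
      Finset.le_sup (f := id) (Finset.mem_filter.2 ⟨hT, hTS⟩)
    have hXS : X ⊆ S ∧ Disjoint e X := by
      rcases Finset.mem_insert.1 hX with rfl | hX
      · simp
      have hsub : X ⊆ S := by
        rcases Finset.mem_insert.1 hS with rfl | hS
        · exact Finset.subset_univ _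
        · exact (hchain X hX S hS).resolve_right fun h => hvX (h hvS.1)
      refine ⟨hsub, Finset.disjoint_left.2 fun a ha haX => (Finset.mem_sdiff.1 (heS ha)).2 ?_⟩
      exact hbelow X hX (Finset.ssubset_iff_subset_ne.2 ⟨hsub, fun h => hvX (h ▸ hvS.1)⟩) haX
    have hSY : S ⊆ Y := by
      rcases Finset.mem_insert.1 hY with rfl | hY
      · exact Finset.subset_univ _
      by_contra hSY
      have hYS : Y ⊆ S := by
        rcases Finset.mem_insert.1 hS with rfl | hS
        · exact Finset.subset_univ _
        · exact (hchain Y hY S hS).resolve_right hSY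
      exact hvS.2 (hbelow Y hY ⟨hYS, hSY⟩ hvY)
    rw [add_comm, ← hcard, ← Finset.card_union_of_disjoint hXS.2]
    exact Finset.card_le_card
      ((Finset.union_subset (heS.trans Finset.sdiff_subset) hXS.1).trans hSY)
  · obtain ⟨X, hX, hvX, hXmax⟩ := exists_greatest_notMem (v := v) hchain
    obtain ⟨Y, hY, hvY, hYmin⟩ := exists_least_mem (v := v) hchain
    have hXY := h X hX Y hY hvX hvY
    have hc : k ≤ (Y \ X).card := by
      have := Finset.le_card_sdiff X Y
      omega
    obtain ⟨e, hve, heY, hek⟩ := Finset.exists_subsuperset_card_eq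
      (Finset.singleton_subset_iff.2 (Finset.mem_sdiff.2 ⟨hvY, hvX⟩)) (by simpa using hk) hc
    refine ⟨e, ?_, Y, hY, heY.trans (Finset.sdiff_subset_sdiff subset_rfl ?_)⟩
    · simpa [hek] using hve
    · refine Finset.sup_le fun T hT => ?_
      obtain ⟨hT, hTY⟩ := Finset.mem_filter.1 hT
      exact hXmax T hT fun hvT => hTY.2 (hYmin T hT hvT)

theorem IsStarFace.mono (hF : IsStarFace k v F) (hG : G ⊆ F) : IsStarFace k v G :=
  ⟨fun S hS => hF.1 S (hG hS), fun S hS T hT => hF.2.1 S (hG hS) T (hG hT),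
    fun X hX Y hY => hF.2.2 X (Finset.insert_subset_insert _ hG hX) Y
      (Finset.insert_subset_insert _ hG hY)⟩

/-- Criterion for inserting a set into a face. -/
theorem IsStarFace.insert_set (hF : IsStarFace k v F) {S : Finset (Fin n)} (hne : S.Nonempty)
    (huniv : S ≠ Finset.univ) (hchain : ∀ T ∈ F, S ⊆ T ∨ T ⊆ S)
    (hv : v ∈ S → ∀ X ∈ insert ∅ F, v ∉ X → X.card + k ≤ S.card)
    (hv' : v ∉ S → ∀ Y ∈ insert Finset.univ F, v ∈ Y → S.card + k ≤ Y.card) :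
    IsStarFace k v (insert S F) := by
  refine ⟨?_, ?_, ?_⟩
  · intro T hT
    rcases Finset.mem_insert.1 hT with rfl | hT
    · exact ⟨hne, huniv⟩
    · exact hF.1 T hT
  · intro T hT U hU
    rw [Finset.mem_insert] at hT hU
    rcases hT with rfl | hT <;> rcases hU with rfl | hU
    · exact Or.inl subset_rfl
    · exact hchain U hU
    · exact (hchain T hT).symm
    · exact hF.2.1 T hT U hU
  · intro X hX Y hY hvX hvY
    rw [Finset.insert_comm, Finset.mem_insert] at hX hY
    rcases hX with rfl | hX <;> rcases hY with rfl | hY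
    · exact absurd hvY hvX
    · exact hv' hvX Y hY hvY
    · exact hv hvY X hX hvX
    · exact hF.2.2 X hX Y hY hvX hvY

theorem IsStarFace.eq_of_card_eq (hF : IsStarFace k v F) {S T : Finset (Fin n)} (hS : S ∈ F)
    (hT : T ∈ F) (h : S.card = T.card) : S = T := by
  rcases hF.2.1 S hS T hT with h' | h'
  · exact Finset.eq_of_subset_of_card_le h' h.ge
  · exact (Finset.eq_of_subset_of_card_le h' h.le).symm

/-- If the block containing `v` has more than `k` elements, one of them can be split off at
its end. -/
theorem IsStarFace.exists_insert_of_lt (hF : IsStarFace k v F) (hk : 2 ≤ k)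
    (h : ∀ X ∈ insert ∅ F, ∀ Y ∈ insert Finset.univ F, v ∉ X → v ∈ Y → X.card + k < Y.card) :
    ∃ S ∉ F, v ∈ S ∧ IsStarFace k v (insert S F) := by
  obtain ⟨X, hX, hvX, hXmax⟩ := exists_greatest_notMem (v := v) hF.2.1
  obtain ⟨Y, hY, hvY, hYmin⟩ := exists_least_mem (v := v) hF.2.1
  have hXY := h X hX Y hY hvX hvY
  have hc : 1 < (Y \ X).card := by
    have := Finset.le_card_sdiff X Y
    omega
  obtain ⟨y, hy, hyv⟩ := Finset.exists_mem_ne hc v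
  rw [Finset.mem_sdiff] at hy
  have hcard := Finset.card_erase_add_one hy.1
  have hvS : v ∈ Y.erase y := Finset.mem_erase.2 ⟨hyv.symm, hvY⟩
  refine ⟨Y.erase y, fun hS => ?_, hvS, hF.insert_set ⟨v, hvS⟩ ?_ ?_ ?_ (absurd hvS)⟩
  · exact Finset.notMem_erase y Y (hYmin _ hS hvS hy.1)
  · exact fun hu => Finset.notMem_erase y Y (hu ▸ Finset.mem_univ y)
  · intro T hT
    by_cases hvT : v ∈ T
    · exact Or.inl ((Finset.erase_subset _ _).trans (hYmin T hT hvT))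
    · right
      have hTX := hXmax T hT hvT
      refine Finset.subset_erase.2 ⟨?_, fun hyT => hy.2 (hTX hyT)⟩
      rcases Finset.mem_insert.1 hY with rfl | hY
      · exact Finset.subset_univ _
      · exact (hF.2.1 T hT Y hY).resolve_right fun h' => hvT (h' hvY)
  · intro _ X' hX' hvX'
    have := h X' hX' Y hY hvX' hvY
    omega

/-- A chain can be refined by a set of any given cardinality that it lacks. -/
theorem exists_refine (hF : ∀ S ∈ F, ∀ T ∈ F, S ⊆ T ∨ T ⊆ S) {r : ℕ} (hr0 : 0 < r)
    (hrn : r < n) (hr : ∀ S ∈ F, S.card ≠ r) :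
    ∃ S : Finset (Fin n), S.card = r ∧ ∀ T ∈ F, S ⊆ T ∨ T ⊆ S := by
  obtain ⟨U, hU, hUmax⟩ := Finset.exists_max_image ((insert ∅ F).filter (·.card < r))
    Finset.card ⟨∅, by simp [hr0]⟩
  obtain ⟨V, hV, hVmin⟩ := Finset.exists_min_image ((insert Finset.univ F).filter (r < ·.card))
    Finset.card ⟨Finset.univ, by simp [hrn]⟩
  rw [Finset.mem_filter, Finset.mem_insert] at hU hV
  have hchain : ∀ A, A = ∅ ∨ A ∈ F → ∀ B, B = Finset.univ ∨ B ∈ F → A.card ≤ B.card →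
      A ⊆ B := by
    rintro A (rfl | hA) B (rfl | hB) hAB
    · simp
    · simp
    · simp
    · exact (hF A hA B hB).elim id fun h => (Finset.eq_of_subset_of_card_le h hAB).symm.subset
  obtain ⟨S, hUS, hSV, hS⟩ := Finset.exists_subsuperset_card_eq
    (hchain U hU.1 V hV.1 (by omega)) hU.2.le hV.2.le
  refine ⟨S, hS, fun T hT => ?_⟩
  rcases lt_or_gt_of_ne (hr T hT) with h | h
  · right
    have hc := hUmax T (Finset.mem_filter.2 ⟨Finset.mem_insert_of_mem hT, h⟩)
    rcases hU.1 with rfl | hU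
    · simp at hc
      simp [hc]
    · exact (hchain T (Or.inr hT) U (Or.inr hU) hc).trans hUS
  · left
    have hc := hVmin T (Finset.mem_filter.2 ⟨Finset.mem_insert_of_mem hT, h⟩)
    rcases hV.1 with rfl | hV
    · exact hSV.trans (Finset.eq_of_subset_of_card_le (Finset.subset_univ T) hc).symm.subset
    · exact hSV.trans (hchain V (Or.inr hV) T (Or.inr hT) hc)

/-- The sizes of the members of a face avoiding and containing `v` lie in two intervals separated
by a gap of length `k`, and the inner end of each interval is attained. -/
theorem IsStarFace.exists_card_bounds (hF : IsStarFace k v F) :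
    ∃ X ∈ insert ∅ F, ∃ Y ∈ insert Finset.univ F, v ∉ X ∧ v ∈ Y ∧ X.card + k ≤ Y.card ∧
      (∀ T ∈ insert ∅ F, v ∉ T → T.card ≤ X.card) ∧
      (∀ T ∈ insert Finset.univ F, v ∈ T → Y.card ≤ T.card) ∧
      (F.filter (v ∉ ·)).image Finset.card ⊆ Finset.Icc 1 X.card ∧
      (F.filter (v ∈ ·)).image Finset.card ⊆ Finset.Ico Y.card n := by
  obtain ⟨X, hX, hvX, hXmax⟩ := exists_greatest_notMem (v := v) hF.2.1
  obtain ⟨Y, hY, hvY, hYmin⟩ := exists_least_mem (v := v) hF.2.1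
  refine ⟨X, hX, Y, hY, hvX, hvY, hF.2.2 X hX Y hY hvX hvY, ?_, ?_, ?_, ?_⟩
  · intro T hT hvT
    rcases Finset.mem_insert.1 hT with rfl | hT
    · simp
    · exact Finset.card_le_card (hXmax T hT hvT)
  · intro T hT hvT
    rcases Finset.mem_insert.1 hT with rfl | hT
    · exact Finset.card_le_card (Finset.subset_univ _)
    · exact Finset.card_le_card (hYmin T hT hvT)
  · refine Finset.image_subset_iff.2 fun T hT => ?_
    obtain ⟨hT, hvT⟩ := Finset.mem_filter.1 hT
    exact Finset.mem_Icc.2 ⟨(hF.1 T hT).1.card_pos, Finset.card_le_card (hXmax T hT hvT)⟩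
  · refine Finset.image_subset_iff.2 fun T hT => ?_
    obtain ⟨hT, hvT⟩ := Finset.mem_filter.1 hT
    refine Finset.mem_Ico.2 ⟨Finset.card_le_card (hYmin T hT hvT), ?_⟩
    simpa using Finset.card_lt_card (Finset.ssubset_univ_iff.2 (hF.1 T hT).2)

theorem IsStarFace.card_image_filter (hF : IsStarFace k v F) (P : Finset (Fin n) → Prop)
    [DecidablePred P] : ((F.filter P).image Finset.card).card = (F.filter P).card :=
  Finset.card_image_of_injOn fun _ hS _ hT h =>
    hF.eq_of_card_eq (Finset.mem_filter.1 hS).1 (Finset.mem_filter.1 hT).1 h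

theorem card_filter_mem_add (v : Fin n) (F : Finset (Finset (Fin n))) :
    (F.filter (v ∈ ·)).card + (F.filter (v ∉ ·)).card = F.card :=
  Finset.card_filter_add_card_filter_not _

theorem IsStarFace.card_le (hF : IsStarFace k v F) : F.card ≤ n - k := by
  obtain ⟨X, -, Y, -, -, -, hXY, -, -, h₁, h₂⟩ := hF.exists_card_bounds
  have h₁ := Finset.card_le_card h₁
  have h₂ := Finset.card_le_card h₂
  rw [hF.card_image_filter] at h₁ h₂
  rw [Nat.card_Icc] at h₁
  rw [Nat.card_Ico] at h₂
  have := card_filter_mem_add v F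
  have : Y.card ≤ n := by simpa using Finset.card_le_univ Y
  omega

/-- The sizes of the members of a face of the largest possible cardinality are determined by the
number of members avoiding `v`. -/
theorem IsStarFace.image_card_eq (hF : IsStarFace k v F) (hc : F.card = n - k) :
    (F.filter (v ∉ ·)).image Finset.card = Finset.Icc 1 (F.filter (v ∉ ·)).card ∧
      (F.filter (v ∈ ·)).image Finset.card =
        Finset.Ico ((F.filter (v ∉ ·)).card + k) n := by
  obtain ⟨X, -, Y, -, -, -, hXY, -, -, h₁, h₂⟩ := hF.exists_card_bounds
  have h₁' := Finset.card_le_card h₁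
  have h₂' := Finset.card_le_card h₂
  rw [hF.card_image_filter] at h₁' h₂'
  rw [Nat.card_Icc] at h₁'
  rw [Nat.card_Ico] at h₂'
  have hsum := card_filter_mem_add v F
  have hY : Y.card ≤ n := by simpa using Finset.card_le_univ Y
  have hX : X.card = (F.filter (v ∉ ·)).card := by omega
  have hY' : Y.card = (F.filter (v ∉ ·)).card + k := by omega
  rw [← hY', ← hX]
  refine ⟨Finset.eq_of_subset_of_card_le h₁ ?_, Finset.eq_of_subset_of_card_le h₂ ?_⟩ <;>
    rw [hF.card_image_filter]
  · rw [Nat.card_Icc]; omega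
  · rw [Nat.card_Ico]; omega

/-- Every face of less than the largest possible cardinality extends. -/
theorem IsStarFace.exists_insert (hF : IsStarFace k v F) (hk : 2 ≤ k) (hc : F.card < n - k) :
    ∃ S ∉ F, IsStarFace k v (insert S F) := by
  obtain ⟨X, hX, Y, hY, hvX, hvY, hXY, hXmax, hYmin, h₁, h₂⟩ := hF.exists_card_bounds
  by_cases hlt : X.card + k < Y.card
  · obtain ⟨S, hS, -, h⟩ := hF.exists_insert_of_lt hk fun X' hX' Y' hY' hvX' hvY' => by
      have := hXmax X' hX' hvX'
      have := hYmin Y' hY' hvY'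
      omega
    exact ⟨S, hS, h⟩
  have hYn : Y.card ≤ n := by simpa using Finset.card_le_univ Y
  obtain ⟨r, hr, hrF⟩ : ∃ r ∈ Finset.Icc 1 X.card ∪ Finset.Ico Y.card n,
      r ∉ F.image Finset.card := by
    by_contra! hcon
    have hle := (Finset.card_le_card (t := F.image Finset.card) hcon).trans Finset.card_image_le
    rw [Finset.card_union_of_disjoint, Nat.card_Icc, Nat.card_Ico] at hle
    · omega
    · refine Finset.disjoint_left.2 fun a ha hb => ?_
      rw [Finset.mem_Icc] at ha
      rw [Finset.mem_Ico] at hb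
      omega
  have hrF : ∀ S ∈ F, S.card ≠ r := fun S hS h => hrF (Finset.mem_image.2 ⟨S, hS, h⟩)
  rw [Finset.mem_union, Finset.mem_Icc, Finset.mem_Ico] at hr
  obtain ⟨S, hS, hchain⟩ := exists_refine hF.2.1 (r := r) (by omega) (by omega) hrF
  refine ⟨S, fun h => hrF S h hS, hF.insert_set ?_ ?_ hchain ?_ ?_⟩
  · exact Finset.card_pos.1 (by omega)
  · rintro rfl
    simp at hS
    omega
  · intro hvS X' hX' hvX'
    have := hXmax X' hX' hvX'
    rcases hr with hr | hr
    · rcases Finset.mem_insert.1 hX with rfl | hX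
      · simp at hr
        omega
      · rcases hchain X hX with h | h
        · exact absurd (h hvS) hvX
        · exact absurd (le_antisymm (hS ▸ Finset.card_le_card h) hr.2) (hrF X hX)
    · omega
  · intro hvS Y' hY' hvY'
    have := hYmin Y' hY' hvY'
    rcases hr with hr | hr
    · omega
    · rcases Finset.mem_insert.1 hY with rfl | hY
      · simp at hr
        omega
      · rcases hchain Y hY with h | h
        · exact absurd (le_antisymm hr.1 (hS ▸ Finset.card_le_card h)) (hrF Y hY)
        · exact absurd (h hvY) hvS

theorem isFacetIn_lamFaces_star (hk : 2 ≤ k) :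
    IsFacetIn (lamFaces n ((Finset.powersetCard k Finset.univ).filter (fun e => v ∈ e))) F ↔
      IsStarFace k v F ∧ F.card = n - k := by
  simp only [IsFacetIn, mem_lamFaces_star (show 1 ≤ k by omega)]
  refine and_congr_right fun hF => ⟨fun hmax => ?_, fun hc G hG hFG => ?_⟩
  · refine hF.card_le.antisymm (le_of_not_gt fun hlt => ?_)
    obtain ⟨S, hS, h⟩ := hF.exists_insert hk hlt
    exact hS (hmax _ h (Finset.subset_insert S F) ▸ Finset.mem_insert_self S F)
  · exact Finset.eq_of_subset_of_card_le hFG (hc ▸ hG.card_le)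

theorem exists_isStarFace_card_eq (hk : 2 ≤ k) (hkn : k ≤ n) (v : Fin n) :
    ∃ F, IsStarFace k v F ∧ F.card = n - k := by
  suffices ∀ m ≤ n - k, ∃ F, IsStarFace k v F ∧ F.card = m from this _ le_rfl
  intro m
  induction m with
  | zero => exact fun _ => ⟨∅, by simpa [IsStarFace] using hkn, rfl⟩
  | succ m ih =>
    intro hm
    obtain ⟨F, hF, hc⟩ := ih (by omega)
    obtain ⟨S, hS, h⟩ := hF.exists_insert hk (by omega)
    exact ⟨_, h, by rw [Finset.card_insert_of_notMem hS, hc]⟩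

/-- Among the pairs out of order in a face, some pair is separated by a single member. -/
theorem IsStarFace.exists_unique_separator (hF : IsStarFace k v F) (hk : 2 ≤ k)
    {S : Finset (Fin n)} (hS : S ∈ F) {x y : Fin n} (hxv : x ≠ v) (hyv : y ≠ v) (hyx : y < x)
    (hxS : x ∈ S) (hyS : y ∉ S) :
    ∃ x' y', x' ≠ v ∧ y' ≠ v ∧ y' < x' ∧ ∃ T ∈ F, x' ∈ T ∧ y' ∉ T ∧ x ∈ T ∧ y ∉ T ∧
      ∀ U ∈ F, x' ∈ U → y' ∉ U → U = T := by
  obtain ⟨m, hm⟩ : ∃ m, (F.filter fun U => x ∈ U ∧ y ∉ U).card = m := ⟨_, rfl⟩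
  induction m using Nat.strong_induction_on generalizing x y S with
  | _ m ih =>
  by_cases huniq : ∀ U ∈ F, x ∈ U → y ∉ U → U = S
  · exact ⟨x, y, hxv, hyv, hyx, S, hS, hxS, hyS, hxS, hyS, huniq⟩
  obtain ⟨T₁, hT₁, T₂, hT₂, hx₁, hy₂, hlt⟩ : ∃ T₁ ∈ F, ∃ T₂ ∈ F, x ∈ T₁ ∧ y ∉ T₂ ∧ T₁ ⊂ T₂ := by
    push Not at huniq
    obtain ⟨U, hU, hxU, hyU, hne⟩ := huniq
    rcases hF.2.1 U hU S hS with h | h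
    · exact ⟨U, hU, S, hS, hxU, hyS, Finset.ssubset_iff_subset_ne.2 ⟨h, hne⟩⟩
    · exact ⟨S, hS, U, hU, hxS, hyU, Finset.ssubset_iff_subset_ne.2 ⟨h, hne.symm⟩⟩
  obtain ⟨z, hz₂, hz₁, hzv⟩ : ∃ z ∈ T₂, z ∉ T₁ ∧ z ≠ v := by
    by_cases hv : v ∉ T₁ ∧ v ∈ T₂
    · have h₁ := hF.2.2 T₁ (Finset.mem_insert_of_mem hT₁) T₂ (Finset.mem_insert_of_mem hT₂)
        hv.1 hv.2
      have h₂ := Finset.le_card_sdiff T₁ T₂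
      obtain ⟨z, hz, hzv⟩ := Finset.exists_mem_ne (show 1 < (T₂ \ T₁).card by omega) v
      rw [Finset.mem_sdiff] at hz
      exact ⟨z, hz.1, hz.2, hzv⟩
    · obtain ⟨z, hz₂, hz₁⟩ := Finset.exists_of_ssubset hlt
      exact ⟨z, hz₂, hz₁, fun h => hv ⟨h ▸ hz₁, h ▸ hz₂⟩⟩
  have hy₁ : y ∉ T₁ := fun h => hy₂ (hlt.1 h)
  have hx₂ : x ∈ T₂ := hlt.1 hx₁
  have hzx : z ≠ x := fun h => hz₁ (h ▸ hx₁)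
  rcases lt_or_gt_of_ne hzx with hzx | hzx
  · have hsub : ∀ U ∈ F, x ∈ U → z ∉ U → y ∉ U := fun U hU _ hzU hyU =>
      (hF.2.1 U hU T₂ hT₂).elim (fun h => hy₂ (h hyU)) fun h => hzU (h hz₂)
    have hcard : (F.filter fun U => x ∈ U ∧ z ∉ U).card < m := by
      rw [← hm]
      refine Finset.card_lt_card (Finset.ssubset_iff_of_subset ?_ |>.2 ⟨T₂, ?_, ?_⟩)
      · intro U hU
        rw [Finset.mem_filter] at hU ⊢
        exact ⟨hU.1, hU.2.1, hsub U hU.1 hU.2.1 hU.2.2⟩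
      · simp [hT₂, hx₂, hy₂]
      · simp [hz₂]
    obtain ⟨x', y', h₁, h₂, h₃, T, hT, h₄, h₅, h₆, h₇, h₈⟩ :=
      ih _ hcard hT₁ hxv hzv hzx hx₁ hz₁ rfl
    exact ⟨x', y', h₁, h₂, h₃, T, hT, h₄, h₅, h₆, hsub T hT h₆ h₇, h₈⟩
  · have hsub : ∀ U ∈ F, z ∈ U → y ∉ U → x ∈ U := fun U hU hzU _ =>
      (hF.2.1 U hU T₁ hT₁).elim (fun h => absurd (h hzU) hz₁) fun h => h hx₁
    have hcard : (F.filter fun U => z ∈ U ∧ y ∉ U).card < m := by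
      rw [← hm]
      refine Finset.card_lt_card (Finset.ssubset_iff_of_subset ?_ |>.2 ⟨T₁, ?_, ?_⟩)
      · intro U hU
        rw [Finset.mem_filter] at hU ⊢
        exact ⟨hU.1, hsub U hU.1 hU.2.1 hU.2.2, hU.2.2⟩
      · simp [hT₁, hx₁, hy₁]
      · simp [hz₁]
    obtain ⟨x', y', h₁, h₂, h₃, T, hT, h₄, h₅, h₆, h₇, h₈⟩ :=
      ih _ hcard hT₂ hzv hyv (hyx.trans hzx) hz₂ hy₂ rfl
    exact ⟨x', y', h₁, h₂, h₃, T, hT, h₄, h₅, hsub T hT h₆ h₇, h₇, h₈⟩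

/-- The sum of the elements of all members of a family of sets. -/
def weight (F : Finset (Finset (Fin n))) : ℕ := ∑ S ∈ F, ∑ x ∈ S, (x : ℕ)

/-- Exchanging a pair out of order that is separated by a single member `T` of a face yields a
face of smaller weight. -/
theorem IsStarFace.exists_swap (hF : IsStarFace k v F) {x y : Fin n} (hxv : x ≠ v)
    (hyv : y ≠ v) (hyx : y < x) {T : Finset (Fin n)} (hT : T ∈ F) (hxT : x ∈ T) (hyT : y ∉ T)
    (huniq : ∀ U ∈ F, x ∈ U → y ∉ U → U = T) :
    ∃ F', IsStarFace k v F' ∧ F'.card = F.card ∧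
      (F'.filter (v ∉ ·)).card = (F.filter (v ∉ ·)).card ∧ weight F' < weight F ∧
      F.erase T ⊆ F' := by
  have hyT' : y ∉ T.erase x := fun h => hyT (Finset.mem_of_mem_erase h)
  set T' := insert y (T.erase x) with hT'
  have hcardT : T'.card = T.card := by
    rw [hT', Finset.card_insert_of_notMem hyT', Finset.card_erase_add_one hxT]
  have hvT : v ∈ T' ↔ v ∈ T := by
    simp [hT', hxv.symm, hyv.symm]
  have hT'F : T' ∉ F := fun h =>
    hyT (hF.eq_of_card_eq h hT hcardT ▸ Finset.mem_insert_self y _)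
  have hface : IsStarFace k v (insert T' (F.erase T)) := by
    refine (hF.mono (Finset.erase_subset T F)).insert_set ⟨y, Finset.mem_insert_self _ _⟩ ?_ ?_ ?_ ?_
    · intro hu
      refine (hF.1 T hT).2 ?_
      rw [← Finset.card_eq_iff_eq_univ, ← hcardT, hu, Finset.card_univ]
    · intro U hU
      obtain ⟨hne, hU⟩ := Finset.mem_erase.1 hU
      rcases hF.2.1 U hU T hT with h | h
      · right
        have hxU : x ∉ U := fun hxU => hne (huniq U hU hxU fun hyU => hyT (h hyU))
        exact (Finset.subset_erase.2 ⟨h, hxU⟩).trans (Finset.subset_insert _ _)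
      · left
        have hyU : y ∈ U := by_contra fun hyU => hne (huniq U hU (h hxT) hyU)
        exact Finset.insert_subset hyU ((Finset.erase_subset _ _).trans h)
    · intro hv X hX hvX
      rw [hcardT]
      exact hF.2.2 X (Finset.insert_subset_insert _ (Finset.erase_subset _ _) hX) T
        (Finset.mem_insert_of_mem hT) hvX (hvT.1 hv)
    · intro hv Y hY hvY
      rw [hcardT]
      exact hF.2.2 T (Finset.mem_insert_of_mem hT) Y
        (Finset.insert_subset_insert _ (Finset.erase_subset _ _) hY) (fun h => hv (hvT.2 h)) hvY
  have hT'E : T' ∉ F.erase T := fun h => hT'F (Finset.mem_of_mem_erase h)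
  refine ⟨_, hface, ?_, ?_, ?_, Finset.subset_insert _ _⟩
  · rw [Finset.card_insert_of_notMem hT'E, Finset.card_erase_add_one hT]
  · rw [Finset.card_filter, Finset.card_filter, Finset.sum_insert hT'E,
      ← Finset.add_sum_erase F _ hT]
    simp only [hvT]
  · rw [weight, weight, Finset.sum_insert hT'E, ← Finset.add_sum_erase F _ hT, hT',
      Finset.sum_insert hyT', ← Finset.add_sum_erase T _ hxT]
    have : (y : ℕ) < x := hyx
    omega

/-- If `A ≠ B` have the same size and the sum over `B` is at most that over `A`, then some element
of `A \ B` exceeds some element of `B \ A`. -/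
theorem exists_lt_of_sum_le {A B : Finset (Fin n)} (hc : A.card = B.card) (hne : A ≠ B)
    (hle : ∑ x ∈ B, (x : ℕ) ≤ ∑ x ∈ A, (x : ℕ)) : ∃ x ∈ A, ∃ y ∈ B, x ∉ B ∧ y ∉ A ∧ y < x := by
  by_contra! hcon
  have hAB : (A \ B).Nonempty := Finset.sdiff_nonempty.2 fun h =>
    hne (Finset.eq_of_subset_of_card_le h hc.ge)
  obtain ⟨m, hm, hmax⟩ := Finset.exists_max_image (A \ B) id hAB
  have hc' : (A \ B).card = (B \ A).card := Finset.card_sdiff_comm hc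
  have h₁ : ∑ x ∈ A \ B, (x : ℕ) ≤ (A \ B).card • (m : ℕ) :=
    Finset.sum_le_card_nsmul _ _ _ fun x hx => hmax x hx
  have h₂ : (B \ A).card • ((m : ℕ) + 1) ≤ ∑ x ∈ B \ A, (x : ℕ) := by
    refine Finset.card_nsmul_le_sum _ _ _ fun y hy => ?_
    rw [Finset.mem_sdiff] at hy hm
    refine Nat.succ_le_of_lt (lt_of_le_of_ne (hcon m hm.1 y hy.1 hm.2 hy.2) fun h => ?_)
    exact hy.2 (Fin.ext h ▸ hm.1)
  have h₃ := Finset.sum_inter_add_sum_sdiff A B fun x => (x : ℕ)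
  have h₄ := Finset.sum_inter_add_sum_sdiff B A fun x => (x : ℕ)
  rw [Finset.inter_comm] at h₄
  have h₅ := hAB.card_pos
  rw [← hc'] at h₂
  simp only [smul_eq_mul] at h₁ h₂
  nlinarith

/-- Two different faces of the largest possible cardinality with equally many members avoiding `v`
differ in a pair of corresponding members along which the weight does not increase. -/
theorem IsStarFace.exists_pair_of_weight_le (hF : IsStarFace k v F) (hFc : F.card = n - k)
    (hG : IsStarFace k v G) (hGc : G.card = n - k)
    (hp : (G.filter (v ∉ ·)).card = (F.filter (v ∉ ·)).card) (hne : F ≠ G)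
    (hw : weight G ≤ weight F) :
    ∃ S ∈ F, ∃ T ∈ G, S ≠ T ∧ S.card = T.card ∧ (v ∈ S ↔ v ∈ T) ∧
      ∑ x ∈ T, (x : ℕ) ≤ ∑ x ∈ S, (x : ℕ) := by
  have hex : ∀ S, ∃ T, S ∈ F → T ∈ G ∧ S.card = T.card ∧ (v ∈ S ↔ v ∈ T) := by
    intro S
    by_cases hS : S ∈ F
    · obtain ⟨hF₁, hF₂⟩ := hF.image_card_eq hFc
      obtain ⟨hG₁, hG₂⟩ := hG.image_card_eq hGc
      rw [hp, ← hF₁] at hG₁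
      rw [hp, ← hF₂] at hG₂
      by_cases hv : v ∈ S
      · have := Finset.mem_image_of_mem Finset.card
          (Finset.mem_filter (p := (v ∈ ·)).2 ⟨hS, hv⟩)
        rw [← hG₂, Finset.mem_image] at this
        obtain ⟨T, hT, hc⟩ := this
        rw [Finset.mem_filter] at hT
        exact ⟨T, fun _ => ⟨hT.1, hc.symm, by simp [hv, hT.2]⟩⟩
      · have := Finset.mem_image_of_mem Finset.card
          (Finset.mem_filter (p := (v ∉ ·)).2 ⟨hS, hv⟩)
        rw [← hG₁, Finset.mem_image] at this
        obtain ⟨T, hT, hc⟩ := this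
        rw [Finset.mem_filter] at hT
        exact ⟨T, fun _ => ⟨hT.1, hc.symm, by simp [hv, hT.2]⟩⟩
    · exact ⟨S, fun h => absurd h hS⟩
  choose φ hφ using hex
  by_contra! hcon
  have hlt : ∀ S ∈ F, S ≠ φ S → ∑ x ∈ S, (x : ℕ) < ∑ x ∈ φ S, (x : ℕ) := fun S hS h =>
    hcon S hS _ (hφ S hS).1 h (hφ S hS).2.1 (hφ S hS).2.2
  have hinj : Set.InjOn φ F := fun S hS T hT h => hF.eq_of_card_eq hS hT (by
    rw [(hφ S hS).2.1, (hφ T hT).2.1, h])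
  have hwφ : ∑ S ∈ F, ∑ x ∈ φ S, (x : ℕ) ≤ weight G := by
    rw [← Finset.sum_image (f := fun T : Finset (Fin n) => ∑ x ∈ T, (x : ℕ)) hinj]
    exact Finset.sum_le_sum_of_subset (Finset.image_subset_iff.2 fun S hS => (hφ S hS).1)
  obtain ⟨S, hS, hSφ⟩ : ∃ S ∈ F, S ≠ φ S := by
    by_contra! h
    refine hne (Finset.eq_of_subset_of_card_le (fun S hS => ?_) (by omega))
    rw [h S hS]
    exact (hφ S hS).1
  refine (hw.trans_lt (lt_of_lt_of_le (Finset.sum_lt_sum (fun T hT => ?_) ⟨S, hS, hlt S hS hSφ⟩)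
    hwφ)).false
  by_cases h : T = φ T
  · rw [← h]
  · exact (hlt T hT h).le

/-- The exchange property when the number of members avoiding `v` drops. -/
theorem IsStarFace.exchange_of_card_lt (hF : IsStarFace k v F) (hk : 2 ≤ k)
    (hFc : F.card = n - k) (hG : IsStarFace k v G) (hGc : G.card = n - k)
    (hp : (G.filter (v ∉ ·)).card < (F.filter (v ∉ ·)).card) :
    ∃ F', IsStarFace k v F' ∧ F'.card = n - k ∧
      (F'.filter (v ∉ ·)).card < (F.filter (v ∉ ·)).card ∧ ∃ S ∈ F, S ∉ G ∧ F.erase S ⊆ F' := by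
  have hmem : (F.filter (v ∉ ·)).card ∈ (F.filter (v ∉ ·)).image Finset.card := by
    rw [(hF.image_card_eq hFc).1, Finset.mem_Icc]
    omega
  obtain ⟨X, hX, hXc⟩ := Finset.mem_image.1 hmem
  obtain ⟨hXF, hvX⟩ := Finset.mem_filter.1 hX
  have hXG : X ∉ G := fun h => by
    have := Finset.mem_image_of_mem Finset.card (Finset.mem_filter (p := (v ∉ ·)).2 ⟨h, hvX⟩)
    rw [(hG.image_card_eq hGc).1, Finset.mem_Icc] at this
    omega
  have hlt : ∀ X' ∈ insert ∅ (F.erase X), v ∉ X' → X'.card < X.card := by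
    intro X' hX' hvX'
    rcases Finset.mem_insert.1 hX' with rfl | hX'
    · simpa using Finset.card_pos.2 (hF.1 X hXF).1
    · obtain ⟨hne, hX'⟩ := Finset.mem_erase.1 hX'
      refine lt_of_le_of_ne ?_ fun h => hne (hF.eq_of_card_eq hX' hXF h)
      have := Finset.mem_image_of_mem Finset.card
        (Finset.mem_filter (p := (v ∉ ·)).2 ⟨hX', hvX'⟩)
      rw [(hF.image_card_eq hFc).1, Finset.mem_Icc] at this
      omega
  obtain ⟨S, hS, hvS, hface⟩ := (hF.mono (Finset.erase_subset X F)).exists_insert_of_lt hk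
    fun X' hX' Y hY hvX' hvY => by
      have h₁ := hlt X' hX' hvX'
      have h₂ := hF.2.2 X (Finset.mem_insert_of_mem hXF) Y
        (Finset.insert_subset_insert _ (Finset.erase_subset _ _) hY) hvX hvY
      omega
  refine ⟨_, hface, ?_, ?_, X, hXF, hXG, Finset.subset_insert _ _⟩
  · rw [Finset.card_insert_of_notMem hS, Finset.card_erase_add_one hXF, hFc]
  · rw [Finset.filter_insert, if_neg (not_not.2 hvS), Finset.filter_erase]
    exact Finset.card_erase_lt_of_mem hX

/-- The exchange property when the number of members avoiding `v` stays the same. -/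
theorem IsStarFace.exchange_of_card_eq (hF : IsStarFace k v F) (hk : 2 ≤ k)
    (hFc : F.card = n - k) (hG : IsStarFace k v G) (hGc : G.card = n - k)
    (hp : (G.filter (v ∉ ·)).card = (F.filter (v ∉ ·)).card) (hne : F ≠ G)
    (hw : weight G ≤ weight F) :
    ∃ F', IsStarFace k v F' ∧ F'.card = n - k ∧
      (F'.filter (v ∉ ·)).card = (F.filter (v ∉ ·)).card ∧ weight F' < weight F ∧
      ∃ S ∈ F, S ∉ G ∧ F.erase S ⊆ F' := by
  obtain ⟨S, hS, S', hS', hSS', hc, hv, hle⟩ :=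
    hF.exists_pair_of_weight_le hFc hG hGc hp hne hw
  obtain ⟨x, hxS, y, hyS', hxS', hyS, hyx⟩ := exists_lt_of_sum_le hc hSS' hle
  have hxv : x ≠ v := fun h => hxS' (h ▸ hv.1 (h ▸ hxS))
  have hyv : y ≠ v := fun h => hyS (h ▸ hv.2 (h ▸ hyS'))
  obtain ⟨x', y', hx'v, hy'v, hy'x', T, hT, hx'T, hy'T, hxT, hyT, huniq⟩ :=
    hF.exists_unique_separator hk hS hxv hyv hyx hxS hyS
  obtain ⟨F', hF', hc', hp', hw', hsub⟩ := hF.exists_swap hx'v hy'v hy'x' hT hx'T hy'T huniq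
  refine ⟨F', hF', hc'.trans hFc, hp', hw', T, hT, fun hTG => ?_, hsub⟩
  exact (hG.2.1 T hTG S' hS').elim (fun h => hxS' (h hxT)) fun h => hyT (h hyS')

end StarFaces

/-- Theorem (paper Thm. `ShellableThm2`): for `3 ≤ k ≤ n-1` and a vertex `v`, the coloring
complex `Λ(H)` of the `k`-uniform star hypergraph at `v` (whose hyperedges are all
`k`-element vertex sets containing `v`) is shellable; moreover it is a simplicial complex,
pure of dimension `n-k-1`. -/
theorem coloring_complex_star_shellable (n k : ℕ) (hk : 3 ≤ k) (hkn : k ≤ n - 1)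
    (v : Fin n) :
    Shellable (lamFaces n ((Finset.powersetCard k Finset.univ).filter (fun e => v ∈ e))) ∧
    (∀ F ∈ lamFaces n ((Finset.powersetCard k Finset.univ).filter (fun e => v ∈ e)),
      ∀ G ⊆ F, G ∈ lamFaces n ((Finset.powersetCard k Finset.univ).filter (fun e => v ∈ e))) ∧
    (∃ F, IsFacetIn
      (lamFaces n ((Finset.powersetCard k Finset.univ).filter (fun e => v ∈ e))) F) ∧
    (∀ F, IsFacetIn
      (lamFaces n ((Finset.powersetCard k Finset.univ).filter (fun e => v ∈ e))) F →
      F.card = n - k) := by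
  have hk' : 2 ≤ k := by omega
  refine ⟨?_, ?_, ?_, fun F hF => ((isFacetIn_lamFaces_star hk').1 hF).2⟩
  · refine shellable_of_key (β := ℕ ×ₗ ℕ)
      (fun F => toLex ((F.filter (v ∉ ·)).card, weight F)) fun F G hF hG hne hle => ?_
    simp only [isFacetIn_lamFaces_star hk', Prod.Lex.toLex_le_toLex,
      Prod.Lex.toLex_lt_toLex] at hF hG hle ⊢
    rcases hle with hp | ⟨hp, hw⟩
    · obtain ⟨F', hF', hc, hp', h⟩ := hF.1.exchange_of_card_lt hk' hF.2 hG.1 hG.2 hp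
      exact ⟨F', ⟨hF', hc⟩, Or.inl hp', h⟩
    · obtain ⟨F', hF', hc, hp', hw', h⟩ :=
        hF.1.exchange_of_card_eq hk' hF.2 hG.1 hG.2 hp hne hw
      exact ⟨F', ⟨hF', hc⟩, Or.inr ⟨hp', hw'⟩, h⟩
  · intro F hF G hGF
    rw [mem_lamFaces_star (by omega)] at hF ⊢
    exact hF.mono hGF
  · simp only [isFacetIn_lamFaces_star hk']
    exact exists_isStarFace_card_eq hk' (by omega) v
end

section
/- Let 3 ≤ k ≤ n−1 and let H be the k-uniform hypergraph on {1,...,n} whose hyperedges are all k-element subsets of {1,...,n} containing the vertex 1. Then HC_r(Δ(H)) is nonzero exactly for −1 ≤ r ≤ n−k−1, and for these r, dim HC_r(Δ(H)) = C(n−1, r+1). -/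
open Function

/-- The map `Fin (m+1) → Fin m` which merges the blocks `j` and `j+1` of an
ordered set partition with `m+1` blocks (blocks are indexed from `0`). -/
def mergeMap {m : ℕ} (j : Fin m) : Fin (m + 1) → Fin m := fun x =>
  if h : (x : ℕ) ≤ (j : ℕ) then ⟨(x : ℕ), lt_of_le_of_lt h j.isLt⟩
  else ⟨(x : ℕ) - 1, by have h1 := x.isLt; have h2 := j.isLt; omega⟩

/-- The linear map between spaces of `R`-valued functions on finite bases
given by a "matrix" `M` (rows indexed by `α`, columns by `β`). -/
def matLin {R : Type} [CommRing R] {α β : Type} [Fintype α] (M : α → β → R) :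
    (α → R) →ₗ[R] (β → R) where
  toFun c := fun b => ∑ a, c a * M a b
  map_add' x y := by
    funext b
    simp [add_mul, Finset.sum_add_distrib]
  map_smul' r x := by
    funext b
    simp [Finset.mul_sum, mul_assoc]

/-- Homology of a (piece of a) chain complex: the kernel of the outgoing map `d1`
modulo the image of the incoming map `d2`. -/
abbrev homologyOf {R A B C : Type} [CommRing R] [AddCommGroup A] [AddCommGroup B] [AddCommGroup C]
    [Module R A] [Module R B] [Module R C] (d2 : A →ₗ[R] B) (d1 : B →ₗ[R] C) :=
  LinearMap.ker d1 ⧸ (LinearMap.range d2).comap (LinearMap.ker d1).subtype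

/-- The canonical representatives of faces of the cyclic coloring complex:
ordered set partitions of `{0, …, n-1}` (vertex `i` stands for the vertex `i+1` of the paper)
into `m` nonempty blocks, encoded as surjections `f : Fin n → Fin m` (block `B_{i+1}` is the
fiber `f⁻¹ i`), such that the block containing the vertex `0` is the first one, and
satisfying the extra condition `P m f` (used to encode hyperedge conditions). -/
def CycBas (n : ℕ) (P : (m : ℕ) → (Fin n → Fin m) → Prop) (m : ℕ) :=
  {f : Fin n → Fin m // Surjective f ∧ (∀ x : Fin n, (x : ℕ) = 0 → (f x : ℕ) = 0) ∧ P m f}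

instance (n : ℕ) (P : (m : ℕ) → (Fin n → Fin m) → Prop) (m : ℕ) : Finite (CycBas n P m) := by
  unfold CycBas; infer_instance

noncomputable instance (n : ℕ) (P : (m : ℕ) → (Fin n → Fin m) → Prop) (m : ℕ) :
    Fintype (CycBas n P m) := Fintype.ofFinite _

instance (n : ℕ) (P : (m : ℕ) → (Fin n → Fin m) → Prop) (m : ℕ) :
    DecidableEq (CycBas n P m) := by unfold CycBas; infer_instance

/-- The matrix of the boundary map of the cyclic coloring complex, from chains with `m+1`
blocks to chains with `m` blocks.  The first summand comes from merging consecutive blocks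
`B_i, B_{i+1}` (`1 ≤ i ≤ r+1`, with sign `(-1)^{i+1}`), the second from merging `B_1` with the
last block `B_{r+2}` (with sign `(-1)^{r+3}`, and `r + 2 = m + 1`).  Terms whose merged
partition does not satisfy the condition `P` do not appear (they match no element `g`). -/
def cycMat (n : ℕ) (P : (m : ℕ) → (Fin n → Fin m) → Prop) (m : ℕ)
    (f : CycBas n P (m + 1)) (g : CycBas n P m) : ℚ :=
  (∑ j : Fin m, (-1 : ℚ) ^ (j : ℕ) * (if mergeMap j ∘ f.1 = g.1 then 1 else 0))
    + (-1 : ℚ) ^ m * (if (∀ y : Fin n, ((f.1 y : ℕ) = m → (g.1 y : ℕ) = 0) ∧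
        ((f.1 y : ℕ) ≠ m → (g.1 y : ℕ) = (f.1 y : ℕ))) then 1 else 0)

/-- The boundary map of the cyclic coloring complex. -/
noncomputable def cycBnd (n : ℕ) (P : (m : ℕ) → (Fin n → Fin m) → Prop) (m : ℕ) :
    (CycBas n P (m + 1) → ℚ) →ₗ[ℚ] (CycBas n P m → ℚ) := matLin (cycMat n P m)

/-- Hyperedge condition for the complex `Δ(H)` where `H` is the complete `k`-uniform
hypergraph on `n` vertices: at least one block (= fiber of `f`) contains a hyperedge,
i.e. some `k`-element subset of the vertices lies inside one block. -/
def completeIn (n k : ℕ) : (m : ℕ) → (Fin n → Fin m) → Prop := fun m f =>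
  ∃ e : Finset (Fin n), e.card = k ∧ ∃ i : Fin m, ∀ x ∈ e, f x = i

/-- Hyperedge condition for the complex `Δ(H)` where `H` is the `k`-uniform star
hypergraph at the vertex `1` (encoded as the element of `Fin n` with value `0`):
some block contains a `k`-element set containing the vertex `1`. -/
def starIn (n k : ℕ) : (m : ℕ) → (Fin n → Fin m) → Prop := fun m f =>
  ∃ e : Finset (Fin n), e.card = k ∧ (∀ x : Fin n, (x : ℕ) = 0 → x ∈ e) ∧
    ∃ i : Fin m, ∀ x ∈ e, f x = i

/-- Condition for the quotient complex `Δ(H)^C` where `H` is the complete `k`-uniform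
hypergraph: no block contains a hyperedge. -/
def completeFree (n k : ℕ) : (m : ℕ) → (Fin n → Fin m) → Prop := fun m f =>
  ∀ e : Finset (Fin n), e.card = k → ∀ i : Fin m, ∃ x ∈ e, f x ≠ i

/-- Condition for the quotient complex `Δ(H')^C` where `H'` is the `k`-uniform star
hypergraph at the vertex `1`: no block contains a hyperedge of `H'`. -/
def starFree (n k : ℕ) : (m : ℕ) → (Fin n → Fin m) → Prop := fun m f =>
  ∀ e : Finset (Fin n), e.card = k → (∀ x : Fin n, (x : ℕ) = 0 → x ∈ e) →
    ∀ i : Fin m, ∃ x ∈ e, f x ≠ i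

/-- The effect on block indices of the `j`-th face map, from `m + 1` blocks to `m` blocks: for
`j < m` the blocks `j` and `j + 1` are merged, otherwise the last block is merged into the first. -/
def mergeVal (m j x : ℕ) : ℕ :=
  if j < m then (if x ≤ j then x else x - 1) else (if x = m then 0 else x)

lemma mergeVal_lt {m j x : ℕ} (hm : 0 < m) (hx : x < m + 1) : mergeVal m j x < m := by
  unfold mergeVal; split_ifs <;> omega

lemma mergeVal_zero (m j : ℕ) : mergeVal m j 0 = 0 := by
  unfold mergeVal; split_ifs <;> omega

lemma mergeVal_comm {m i j x : ℕ} (hij : i < j) (hj : j ≤ m + 1) (hx : x < m + 2) :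
    mergeVal m i (mergeVal (m + 1) j x) = mergeVal m (j - 1) (mergeVal (m + 1) i x) := by
  unfold mergeVal; split_ifs <;> omega

lemma exists_mergeVal_eq {m j x : ℕ} (hx : x < m) : ∃ y < m + 1, mergeVal m j y = x := by
  by_cases h : x ≤ j
  · exact ⟨x, by omega, by unfold mergeVal; split_ifs <;> omega⟩
  · exact ⟨x + 1, by omega, by unfold mergeVal; split_ifs <;> omega⟩

lemma starIn_iff {n k m : ℕ} (hn : 0 < n) (f : Fin n → Fin m)
    (hf : ∀ x : Fin n, (x : ℕ) = 0 → (f x : ℕ) = 0) :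
    starIn n k m f ↔ ∃ e : Finset (Fin n), e.card = k ∧ (∀ x : Fin n, (x : ℕ) = 0 → x ∈ e) ∧
      ∀ x ∈ e, (f x : ℕ) = 0 := by
  constructor
  · rintro ⟨e, h1, h2, i, h3⟩
    refine ⟨e, h1, h2, fun x hx => ?_⟩
    rw [h3 x hx, ← h3 ⟨0, hn⟩ (h2 _ rfl)]
    exact hf _ rfl
  · rintro ⟨e, h1, h2, h3⟩
    exact ⟨e, h1, h2, f ⟨0, hn⟩, fun x hx => Fin.ext (by rw [h3 x hx, hf _ rfl])⟩

/-- The basis of the star cyclic coloring complex formed by the partitions with `m + 1` blocks. -/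
abbrev StarCell (n k m : ℕ) := CycBas n (starIn n k) (m + 1)

namespace StarCell

variable {n k m : ℕ}

/-- The index of the block containing a vertex. -/
def val (f : StarCell n k m) (y : Fin n) : ℕ := f.1 y

lemma ext_val {f g : StarCell n k m} (h : ∀ y, f.val y = g.val y) : f = g :=
  Subtype.ext (funext fun y => Fin.ext (h y))

lemma val_lt (f : StarCell n k m) (y : Fin n) : f.val y < m + 1 := (f.1 y).isLt

lemma val_of_eq_zero (f : StarCell n k m) {y : Fin n} (hy : (y : ℕ) = 0) : f.val y = 0 :=
  f.2.2.1 y hy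

lemma exists_val_eq (f : StarCell n k m) {i : ℕ} (hi : i < m + 1) : ∃ y, f.val y = i := by
  obtain ⟨y, hy⟩ := f.2.1 ⟨i, hi⟩
  exact ⟨y, by simp [val, hy]⟩

lemma le_card_zeroBlock (hn : 0 < n) (f : StarCell n k m) :
    k ≤ (Finset.univ.filter fun y => f.val y = 0).card := by
  obtain ⟨e, h1, -, h3⟩ := (starIn_iff hn f.1 f.2.2.1).1 f.2.2.2
  exact h1.symm.le.trans (Finset.card_le_card fun x hx => by simpa [val] using h3 x hx)

/-- A cell from its block index function. -/
def mk (v : Fin n → ℕ) (hlt : ∀ y, v y < m + 1) (hsurj : ∀ i < m + 1, ∃ y, v y = i)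
    (h0 : ∀ y : Fin n, (y : ℕ) = 0 → v y = 0) (hn : 0 < n)
    (hk : k ≤ (Finset.univ.filter fun y => v y = 0).card) (hk0 : 0 < k) : StarCell n k m :=
  ⟨fun y => ⟨v y, hlt y⟩, fun i => (hsurj i i.isLt).imp fun _ h => Fin.ext h, h0, by
    refine (starIn_iff hn _ h0).2 ?_
    obtain ⟨e, h1, h2, h3⟩ := Finset.exists_subsuperset_card_eq
      (s := {⟨0, hn⟩}) (t := Finset.univ.filter fun y => v y = 0) (n := k)
      (by simpa using h0 ⟨0, hn⟩ rfl) (by rw [Finset.card_singleton]; exact hk0) hk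
    refine ⟨e, h3, fun x hx => h1 (by simpa using Fin.ext hx), fun x hx => ?_⟩
    simpa using h2 hx⟩

@[simp] lemma val_mk (v : Fin n → ℕ) (hlt : ∀ y, v y < m + 1)
    (hsurj : ∀ i < m + 1, ∃ y, v y = i) (h0 : ∀ y : Fin n, (y : ℕ) = 0 → v y = 0) (hn : 0 < n)
    (hk : k ≤ (Finset.univ.filter fun y => v y = 0).card) (hk0 : 0 < k) (y : Fin n) :
    (mk v hlt hsurj h0 hn hk hk0).val y = v y := rfl

lemma isEmpty (hn : 0 < n) (hm : n - k < m) : IsEmpty (StarCell n k m) := by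
  refine ⟨fun f => ?_⟩
  have h1 := f.le_card_zeroBlock hn
  have h2 : m ≤ (Finset.univ.filter fun y => ¬ f.val y = 0).card := by
    calc m = (Finset.Icc 1 m).card := by simp
      _ ≤ ((Finset.univ.filter fun y => ¬ f.val y = 0).image f.val).card := by
        refine Finset.card_le_card fun i hi => ?_
        rw [Finset.mem_Icc] at hi
        obtain ⟨y, hy⟩ := f.exists_val_eq (i := i) (by omega)
        exact Finset.mem_image.2 ⟨y, by simp; omega, hy⟩
      _ ≤ _ := Finset.card_image_le
  have h3 := Finset.card_filter_add_card_filter_not (s := Finset.univ) fun y => f.val y = 0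
  simp only [Finset.card_univ, Fintype.card_fin] at h3
  omega

/-- The `j`-th face of a cell. -/
def face (j : ℕ) (f : StarCell n k (m + 1)) : StarCell n k m :=
  ⟨fun y => ⟨mergeVal (m + 1) j (f.val y), mergeVal_lt (by omega) (f.val_lt y)⟩,
    fun i => by
      obtain ⟨x, hx, hxi⟩ := exists_mergeVal_eq (j := j) i.isLt
      obtain ⟨y, rfl⟩ := f.exists_val_eq hx
      exact ⟨y, Fin.ext hxi⟩,
    fun y hy => by simp [f.val_of_eq_zero hy, mergeVal_zero],
    by
      obtain ⟨e, h1, h2, i, h3⟩ := f.2.2.2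
      exact ⟨e, h1, h2, ⟨mergeVal (m + 1) j i, mergeVal_lt (by omega) i.isLt⟩,
        fun x hx => by simp [val, h3 x hx]⟩⟩

@[simp] lemma val_face (j : ℕ) (f : StarCell n k (m + 1)) (y : Fin n) :
    (f.face j).val y = mergeVal (m + 1) j (f.val y) := rfl

lemma face_face {i j : ℕ} (hij : i < j) (hj : j ≤ m + 2) (f : StarCell n k (m + 2)) :
    (f.face j).face i = (f.face i).face (j - 1) :=
  ext_val fun y => mergeVal_comm hij hj (f.val_lt y)

lemma cycMat_eq (f : StarCell n k (m + 1)) (g : StarCell n k m) :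
    cycMat n (starIn n k) (m + 1) f g =
      ∑ j ∈ Finset.range (m + 2), (-1 : ℚ) ^ j * if f.face j = g then 1 else 0 := by
  have key (j : ℕ) : f.face j = g ↔ ∀ y, mergeVal (m + 1) j (f.1 y) = (g.1 y : ℕ) :=
    ⟨fun h y => by rw [← h]; rfl, fun h => ext_val h⟩
  rw [Finset.sum_range_succ, Finset.sum_range, cycMat]
  congr 1
  · refine Finset.sum_congr rfl fun j _ => ?_
    congr 1
    refine if_congr ?_ rfl rfl
    rw [key, funext_iff]
    refine forall_congr' fun y => ?_
    rw [Fin.ext_iff]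
    simp only [Function.comp, mergeMap, mergeVal, j.isLt, if_true]
    split_ifs <;> rfl
  · congr 1
    refine if_congr ?_ rfl rfl
    rw [key]
    refine forall_congr' fun y => ?_
    simp only [mergeVal, lt_irrefl, if_false]
    split_ifs <;> omega

lemma sum_cycMat_mul (f : StarCell n k (m + 1)) (F : StarCell n k m → ℚ) :
    ∑ g, cycMat n (starIn n k) (m + 1) f g * F g =
      ∑ j ∈ Finset.range (m + 2), (-1 : ℚ) ^ j * F (f.face j) := by
  simp only [cycMat_eq, Finset.sum_mul]
  rw [Finset.sum_comm]
  refine Finset.sum_congr rfl fun j _ => ?_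
  simp [ite_mul]

end StarCell

lemma sum_presimplicial_eq_zero (m : ℕ) (F : ℕ → ℕ → ℚ)
    (hF : ∀ i j, i < j → j ≤ m + 1 → F i j = F (j - 1) i) :
    ∑ j ∈ Finset.range (m + 2), ∑ i ∈ Finset.range (m + 1), (-1 : ℚ) ^ j * ((-1) ^ i * F i j)
      = 0 := by
  rw [← Finset.sum_product']
  refine Finset.sum_involution
    (fun p _ => if p.2 < p.1 then (p.2, p.1 - 1) else (p.2 + 1, p.1)) ?_ ?_ ?_ ?_
  · rintro ⟨j, i⟩ h
    simp only [Finset.mem_product, Finset.mem_range] at h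
    dsimp only
    split_ifs with hij
    · obtain ⟨j, rfl⟩ : ∃ j', j = j' + 1 := ⟨j - 1, by omega⟩
      rw [hF i (j + 1) hij (by omega)]
      simp only [Nat.add_sub_cancel]
      ring
    · rw [hF j (i + 1) (by omega) (by omega)]
      simp only [Nat.add_sub_cancel]
      ring
  · rintro ⟨j, i⟩ h _
    dsimp only
    split_ifs with hij <;> simp only [ne_eq, Prod.mk.injEq] <;> omega
  · rintro ⟨j, i⟩ h
    simp only [Finset.mem_product, Finset.mem_range] at h ⊢
    split_ifs with hij <;> dsimp only <;> omega
  · rintro ⟨j, i⟩ h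
    dsimp only
    by_cases hij : i < j
    · have h1 : ¬ j - 1 < i := by omega
      rw [if_pos hij, if_neg h1, Prod.mk.injEq]; omega
    · have h1 : j < i + 1 := by omega
      rw [if_neg hij, if_pos h1, Prod.mk.injEq]; omega

lemma cycBnd_comp {n : ℕ} (hn : 0 < n) (k m : ℕ) :
    cycBnd n (starIn n k) m ∘ₗ cycBnd n (starIn n k) (m + 1) = 0 := by
  refine LinearMap.ext fun c => funext fun h => ?_
  cases m with
  | zero =>
    exact (h.1 ⟨0, hn⟩).elim0
  | succ m =>
    change ∑ g, (∑ f, c f * cycMat n (starIn n k) (m + 2) f g) *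
      cycMat n (starIn n k) (m + 1) g h = 0
    simp only [Finset.sum_mul, mul_assoc]
    rw [Finset.sum_comm]
    refine Finset.sum_eq_zero fun f _ => ?_
    rw [← Finset.mul_sum, StarCell.sum_cycMat_mul]
    simp only [StarCell.cycMat_eq]
    simp_rw [Finset.mul_sum (Finset.range (m + 2))]
    rw [sum_presimplicial_eq_zero, mul_zero]
    intro i j hij hj
    rw [StarCell.face_face hij hj]

lemma card_le_finrank_range_matLin {α β ι L : Type} [Fintype α] [Fintype β] [Fintype ι]
    [LinearOrder L] (M : α → β → ℚ) (a : ι → α) (b : ι → β) (W : ι → L)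
    (hdiag : ∀ i, M (a i) (b i) ≠ 0)
    (htri : ∀ i j, i ≠ j → M (a i) (b j) ≠ 0 → W i < W j) :
    Fintype.card ι ≤ Module.finrank ℚ (LinearMap.range (matLin M)) := by
  classical
  have hli : LinearIndependent ℚ fun i => M (a i) := by
    rw [Fintype.linearIndependent_iff]
    intro c hc
    by_contra! hne
    obtain ⟨i₁, hi₁⟩ := hne
    obtain ⟨i₀, hi₀, hmin⟩ := Finset.exists_min_image (Finset.univ.filter fun i => c i ≠ 0) W
      ⟨i₁, by simpa using hi₁⟩
    have h := congrFun hc (b i₀)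
    simp only [Finset.sum_apply, Pi.smul_apply, smul_eq_mul, Pi.zero_apply] at h
    rw [Finset.sum_eq_single i₀] at h
    · exact (mul_ne_zero (by simpa using hi₀) (hdiag i₀)) h
    · intro i _ hi
      by_contra hne
      exact absurd (htri i i₀ hi (right_ne_zero_of_mul hne))
        (not_lt.2 (hmin i (by simpa using left_ne_zero_of_mul hne)))
    · simp
  have hmem (i : ι) : M (a i) ∈ LinearMap.range (matLin M) :=
    ⟨Pi.single (a i) 1, funext fun y => by simp [matLin, Pi.single_apply]⟩
  have hli' : LinearIndependent ℚ fun i => (⟨M (a i), hmem i⟩ : LinearMap.range (matLin M)) :=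
    LinearIndependent.of_comp (LinearMap.range (matLin M)).subtype hli
  exact hli'.fintype_card_le_finrank

lemma sum_mul_lt_sum_mul {n j : ℕ} (u u' : Fin n → ℕ) {x₀ x₁ : Fin n} (hx : x₀ < x₁)
    (hu₀ : u x₀ ≤ j + 1) (hu₀' : u' x₀ = j) (hu₁ : u x₁ = j) (hu₁' : u' x₁ = j + 1)
    (hle : ∀ y, y ≠ x₀ → u y ≤ u' y) :
    ∑ y : Fin n, (y : ℕ) * u y < ∑ y : Fin n, (y : ℕ) * u' y := by
  have h1 : x₁ ∈ Finset.univ.erase x₀ := by simp [hx.ne']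
  rw [← Finset.add_sum_erase _ _ (Finset.mem_univ x₀), ← Finset.add_sum_erase _ _ h1,
    ← Finset.add_sum_erase (a := x₀) _ (fun y : Fin n => (y : ℕ) * u' y) (Finset.mem_univ x₀),
    ← Finset.add_sum_erase _ (fun y : Fin n => (y : ℕ) * u' y) h1]
  have h2 : ∑ y ∈ (Finset.univ.erase x₀).erase x₁, (y : ℕ) * u y ≤
      ∑ y ∈ (Finset.univ.erase x₀).erase x₁, (y : ℕ) * u' y := by
    refine Finset.sum_le_sum fun y hy => Nat.mul_le_mul_left _ (hle y ?_)
    simp only [Finset.mem_erase] at hy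
    exact hy.2.1
  have h3 : (x₀ : ℕ) * u x₀ ≤ x₀ * (j + 1) := Nat.mul_le_mul_left _ hu₀
  have h4 : (x₀ : ℕ) < x₁ := hx
  rw [hu₀', hu₁, hu₁']
  nlinarith

namespace StarCell

variable {n k m : ℕ}

/-- The blocks `1, …, p` are singletons, in decreasing order. -/
def DecSingletons (f : StarCell n k m) (p : ℕ) : Prop :=
  ∀ y y', 1 ≤ f.val y → f.val y ≤ f.val y' → f.val y' ≤ p → y' ≤ y

/-- The blocks `1, …, p` are decreasing singletons, and block `p` lies below block `p + 1`:
this cell is matched with its `p`-th face. -/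
def AscentAt (f : StarCell n k m) (p : ℕ) : Prop :=
  1 ≤ p ∧ p < m ∧ f.DecSingletons p ∧ ∀ y y', f.val y = p → f.val y' = p + 1 → y < y'

lemma AscentAt.eq_of_face_eq {f f' : StarCell n k (m + 1)} {j p : ℕ} (hf' : f'.AscentAt p)
    (hj : 1 ≤ j) (hjm : j ≤ m) {q : ℕ} (hf : f.AscentAt q) (h : f.face j = f'.face p) :
    j = p := by
  obtain ⟨hp1, hpm, hdec', hasc'⟩ := hf'
  obtain ⟨hq1, hqm, hdec, hasc⟩ := hf
  have hv (y : Fin n) : mergeVal (m + 1) j (f.val y) = mergeVal (m + 1) p (f'.val y) := by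
    rw [← val_face, h, val_face]
  rcases lt_trichotomy j p with hlt | rfl | hlt
  · obtain ⟨y, hy⟩ := f.exists_val_eq (i := j) (by omega)
    obtain ⟨y', hy'⟩ := f.exists_val_eq (i := j + 1) (by omega)
    have h1 := hv y
    have h2 := hv y'
    have h3 : f'.val y = j := by
      rw [hy] at h1; unfold mergeVal at h1; split_ifs at h1 <;> omega
    have h4 : f'.val y' = j := by
      rw [hy'] at h2; unfold mergeVal at h2; split_ifs at h2 <;> omega
    have h5 := le_antisymm (hdec' y y' (by omega) (by omega) (by omega))
      (hdec' y' y (by omega) (by omega) (by omega))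
    subst h5
    omega
  · rfl
  · exfalso
    by_cases hqp : q + 1 ≤ p
    · obtain ⟨y, hy⟩ := f'.exists_val_eq (i := q) (by omega)
      obtain ⟨y', hy'⟩ := f'.exists_val_eq (i := q + 1) (by omega)
      have h1 := hv y
      have h2 := hv y'
      have h3 : f.val y = q := by
        rw [hy] at h1; unfold mergeVal at h1; split_ifs at h1 <;> omega
      have h4 : f.val y' = q + 1 := by
        rw [hy'] at h2; unfold mergeVal at h2; split_ifs at h2 <;> omega
      exact absurd (hasc y y' h3 h4) (not_lt.2 (hdec' y y' (by omega) (by omega) (by omega)))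
    · obtain ⟨y, hy⟩ := f'.exists_val_eq (i := p) (by omega)
      obtain ⟨y', hy'⟩ := f'.exists_val_eq (i := p + 1) (by omega)
      have h1 := hv y
      have h2 := hv y'
      have h3 : f.val y = p := by
        rw [hy] at h1; unfold mergeVal at h1; split_ifs at h1 <;> omega
      have h4 : f.val y' = p := by
        rw [hy'] at h2; unfold mergeVal at h2; split_ifs at h2 <;> omega
      have h5 := le_antisymm (hdec y y' (by omega) (by omega) (by omega))
        (hdec y' y (by omega) (by omega) (by omega))
      subst h5
      omega

lemma AscentAt.le_of_ascentAt {f : StarCell n k m} {p q : ℕ} (hp : f.AscentAt p)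
    (hq : f.AscentAt q) : q ≤ p := by
  by_contra! hlt
  have hqm := hq.2.1
  obtain ⟨y, hy⟩ := f.exists_val_eq (i := p) (by omega)
  obtain ⟨y', hy'⟩ := f.exists_val_eq (i := p + 1) (by omega)
  have hp1 := hp.1
  exact absurd (hp.2.2.2 y y' hy hy') (not_lt.2 (hq.2.2.1 y y' (by omega) (by omega) (by omega)))

/-- A weight making the matrix of the matching triangular. -/
def weight (f : StarCell n k m) : ℕ ×ₗ ℕ :=
  toLex ((Finset.univ.filter fun y => f.val y = 0).card, ∑ y : Fin n, (y : ℕ) * f.val y)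

lemma weight_lt_of_face_eq {f f' : StarCell n k (m + 1)} {j p q : ℕ} (hjm : j ≤ m + 1)
    (hf : f.AscentAt q) (hf' : f'.AscentAt p) (hne : f ≠ f') (h : f.face j = f'.face p) :
    f.weight < f'.weight := by
  have hv (y : Fin n) : mergeVal (m + 1) j (f.val y) = mergeVal (m + 1) p (f'.val y) := by
    rw [← val_face, h, val_face]
  have hp1 := hf'.1
  have hpm := hf'.2.1
  unfold weight
  rw [Prod.Lex.toLex_lt_toLex]
  dsimp only
  by_cases hj : 1 ≤ j ∧ j ≤ m
  · obtain rfl := hf'.eq_of_face_eq hj.1 hj.2 hf h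
    obtain ⟨x₀, hx₀⟩ := f'.exists_val_eq (i := j) (by omega)
    have hother (y : Fin n) (hy : f'.val y ≠ j) (hy' : f'.val y ≠ j + 1) :
        f.val y = f'.val y := by
      have h1 := hv y
      unfold mergeVal at h1; split_ifs at h1 <;> omega
    have hpair (y : Fin n) (hy : f'.val y = j ∨ f'.val y = j + 1) :
        f.val y = j ∨ f.val y = j + 1 := by
      have h1 := hv y
      unfold mergeVal at h1; split_ifs at h1 <;> omega
    have huniq (y : Fin n) (hy : f'.val y = j) : y = x₀ :=
      le_antisymm (hf'.2.2.1 x₀ y (by omega) (by omega) (by omega))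
        (hf'.2.2.1 y x₀ (by omega) (by omega) (by omega))
    obtain ⟨x₁, hx₁, hx₁'⟩ : ∃ x₁, x₁ ≠ x₀ ∧ f.val x₁ = j := by
      by_contra! hcon
      apply hne
      have hx : f.val x₀ = j := by
        obtain ⟨y, hy⟩ := f.exists_val_eq (i := j) (by omega)
        by_cases hyx : y = x₀
        · rwa [← hyx]
        · exact absurd hy (hcon y hyx)
      refine ext_val fun y => ?_
      by_cases hyx : y = x₀
      · rw [hyx, hx, hx₀]
      · have h1 := hcon y hyx
        have h2 : f'.val y ≠ j := fun h => hyx (huniq y h)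
        by_cases h3 : f'.val y = j + 1
        · have := hpair y (Or.inr h3); omega
        · exact hother y h2 h3
    have hx₁'' : f'.val x₁ = j + 1 := by
      have h2 : f'.val x₁ ≠ j := fun h => hx₁ (huniq x₁ h)
      by_contra h3
      have := hother x₁ h2 h3
      omega
    refine Or.inr ⟨?_, ?_⟩
    · congr 1
      ext y
      simp only [Finset.mem_filter, Finset.mem_univ, true_and]
      have h1 := hv y
      unfold mergeVal at h1; split_ifs at h1 <;> omega
    · refine sum_mul_lt_sum_mul f.val f'.val (hf'.2.2.2 x₀ x₁ hx₀ hx₁'') ?_ hx₀ hx₁' hx₁'' ?_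
      · have := hpair x₀ (Or.inl hx₀); omega
      · intro y hy
        have h2 : f'.val y ≠ j := fun h => hy (huniq y h)
        by_cases h3 : f'.val y = j + 1
        · have := hpair y (Or.inr h3); omega
        · exact (hother y h2 h3).le
  · left
    refine Finset.card_lt_card (Finset.ssubset_iff_subset_ne.2 ⟨fun y => ?_, fun heq => ?_⟩)
    · simp only [Finset.mem_filter, Finset.mem_univ, true_and]
      intro hy
      have h1 := hv y
      rw [hy, mergeVal_zero] at h1
      unfold mergeVal at h1; split_ifs at h1 <;> omega
    · obtain ⟨y, hy⟩ := f.exists_val_eq (i := if j = 0 then 1 else m + 1) (by split_ifs <;> omega)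
      have h1 : f'.val y = 0 := by
        have h1 := hv y
        rw [hy] at h1
        unfold mergeVal at h1; split_ifs at h1 <;> omega
      have h2 : y ∈ Finset.univ.filter fun y => f'.val y = 0 := by simpa using h1
      rw [← heq, Finset.mem_filter] at h2
      have := h2.2
      split_ifs at hy <;> omega

lemma face_eq_face_iff (f : StarCell n k (m + 1)) {j p : ℕ} (hj : j ≤ m + 1) (hp : 1 ≤ p)
    (hpm : p ≤ m) : f.face j = f.face p ↔ j = p := by
  refine ⟨fun h => ?_, fun h => by rw [h]⟩
  obtain ⟨y, hy⟩ := f.exists_val_eq (i := p) (by omega)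
  obtain ⟨y', hy'⟩ := f.exists_val_eq (i := p + 1) (by omega)
  have h1 : (f.face j).val y = (f.face p).val y := by rw [h]
  have h2 : (f.face j).val y' = (f.face p).val y' := by rw [h]
  simp only [val_face, hy, hy'] at h1 h2
  unfold mergeVal at h1 h2; split_ifs at h1 h2 <;> omega

lemma cycMat_face_ne_zero (f : StarCell n k (m + 1)) {p : ℕ} (hp : 1 ≤ p) (hpm : p ≤ m) :
    cycMat n (starIn n k) (m + 1) f (f.face p) ≠ 0 := by
  rw [cycMat_eq, Finset.sum_eq_single p]
  · simp
  · intro j hj hjp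
    rw [Finset.mem_range] at hj
    rw [if_neg (mt (f.face_eq_face_iff (by omega) hp hpm).1 hjp), mul_zero]
  · simp only [Finset.mem_range]; omega

lemma card_ascent_le_finrank_range (n k m : ℕ) :
    Nat.card {f : StarCell n k m // ∃ p, f.AscentAt p} ≤
      Module.finrank ℚ (LinearMap.range (cycBnd n (starIn n k) m)) := by
  classical
  cases m with
  | zero =>
    have : IsEmpty {f : StarCell n k 0 // ∃ p, f.AscentAt p} :=
      ⟨fun ⟨f, p, hp⟩ => absurd hp.2.1 (by omega)⟩
    simp
  | succ m =>
    choose p hp using fun f : {f : StarCell n k (m + 1) // ∃ p, f.AscentAt p} => f.2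
    rw [Nat.card_eq_fintype_card]
    refine card_le_finrank_range_matLin _ Subtype.val
      (fun f => f.1.face (p f)) (fun f => f.1.weight)
      (fun f => f.1.cycMat_face_ne_zero (hp f).1 (by have := (hp f).2.1; omega)) ?_
    intro f f' hne hM
    rw [cycMat_eq] at hM
    obtain ⟨j, hj, hjM⟩ := Finset.exists_ne_zero_of_sum_ne_zero hM
    rw [Finset.mem_range] at hj
    refine weight_lt_of_face_eq (j := j) (by omega) (hp f) (hp f')
      (fun h => hne (Subtype.ext h)) ?_
    by_contra h
    simp [h] at hjM

/-- The cells matched with a cell with one more block. -/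
def SplitAt (f : StarCell n k m) (p : ℕ) : Prop :=
  p < m ∧ f.DecSingletons p ∧
    ∃ y₀, f.val y₀ = p + 1 ∧ (∀ y, f.val y = p + 1 → y₀ ≤ y) ∧
      (∃ y₁, f.val y₁ = p + 1 ∧ y₀ < y₁) ∧ ∀ y, 1 ≤ p → f.val y = p → y₀ < y

lemma ascentAt_or_splitAt_or (f : StarCell n k m) :
    (∃ p, f.AscentAt p) ∨ (∃ p, f.SplitAt p) ∨ f.DecSingletons m := by
  by_contra! hcon
  obtain ⟨h1, h2, h3⟩ := hcon
  suffices ∀ p ≤ m, f.DecSingletons p from h3 (this m le_rfl)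
  intro p
  induction p with
  | zero => intro _ y y' _ _ _; omega
  | succ p ih =>
    intro hp
    have hdec := ih (by omega)
    obtain ⟨y₀, hy₀, hmin⟩ : ∃ y₀, f.val y₀ = p + 1 ∧ ∀ y, f.val y = p + 1 → y₀ ≤ y := by
      obtain ⟨y, hy⟩ := f.exists_val_eq (i := p + 1) (by omega)
      obtain ⟨y₀, hy₀, hmin⟩ := Finset.exists_min_image
        (Finset.univ.filter fun y => f.val y = p + 1) id ⟨y, by simpa using hy⟩
      exact ⟨y₀, by simpa using hy₀, fun y hy => hmin y (by simpa using hy)⟩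
    have hlow : ∀ y, 1 ≤ p → f.val y = p → y₀ < y := by
      by_contra! hcon
      obtain ⟨y, hp1, hy, hle⟩ := hcon
      refine h1 p ⟨hp1, by omega, hdec, fun z z' hz hz' => ?_⟩
      have hzy : z ≤ y := hdec y z (by omega) (by omega) (by omega)
      refine lt_of_le_of_ne (hzy.trans (hle.trans (hmin z' hz'))) ?_
      rintro rfl
      omega
    have hsingle : ∀ y, f.val y = p + 1 → y ≤ y₀ := by
      by_contra! hcon
      obtain ⟨y, hy, hlt⟩ := hcon
      exact h2 p ⟨by omega, hdec, y₀, hy₀, hmin, ⟨y, hy, hlt⟩, hlow⟩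
    intro y y' hy hyy' hy'
    rcases Nat.lt_or_ge p (f.val y') with hlt | hge
    · have hy'₀ := hsingle y' (by omega)
      rcases Nat.lt_or_ge p (f.val y) with hlt' | hge'
      · exact hy'₀.trans (hmin y (by omega))
      · obtain ⟨z, hz⟩ := f.exists_val_eq (i := p) (by omega)
        exact hy'₀.trans ((hlow z (by omega) hz).le.trans
          (hdec y z hy (by omega) (by omega)))
    · exact hdec y y' hy hyy' hge

lemma SplitAt.exists_ascentAt (hn : 0 < n) (hk : 0 < k) {f : StarCell n k m} {p : ℕ}
    (hf : f.SplitAt p) :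
    ∃ g : StarCell n k (m + 1), g.AscentAt (p + 1) ∧ g.face (p + 1) = f := by
  obtain ⟨hpm, hdec, y₀, hy₀, hmin, ⟨y₁, hy₁, hlt⟩, hlow⟩ := hf
  have hval (y : Fin n) : (if f.val y ≤ p ∨ y = y₀ then f.val y else f.val y + 1) = 0 ↔
      f.val y = 0 := by
    split_ifs <;> constructor <;> intro h <;> first | omega | exact h.elim
  refine ⟨mk (fun y => if f.val y ≤ p ∨ y = y₀ then f.val y else f.val y + 1) ?_ ?_ ?_ hn ?_ hk,
    ⟨by omega, by omega, ?_, ?_⟩, ?_⟩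
  · intro y
    have := f.val_lt y
    split_ifs <;> omega
  · intro i hi
    by_cases h1 : i ≤ p
    · obtain ⟨y, hy⟩ := f.exists_val_eq (i := i) (by omega)
      exact ⟨y, by rw [if_pos (Or.inl (by omega)), hy]⟩
    by_cases h2 : i = p + 1
    · exact ⟨y₀, by rw [if_pos (Or.inr rfl), hy₀, h2]⟩
    by_cases h3 : i = p + 2
    · refine ⟨y₁, ?_⟩
      rw [if_neg (by rw [hy₁]; rintro (h | rfl) <;> [omega; exact hlt.false]), hy₁, h3]
    · obtain ⟨y, hy⟩ := f.exists_val_eq (i := i - 1) (by omega)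
      refine ⟨y, ?_⟩
      rw [if_neg (by rintro (h | h) <;> [skip; subst h] <;> omega), hy]
      omega
  · exact fun y hy => (hval y).2 (f.val_of_eq_zero hy)
  · simp_rw [hval]
    exact f.le_card_zeroBlock hn
  · intro y y' h1 h2 h3
    simp only [val_mk] at h1 h2 h3
    have hy' : f.val y' ≤ p ∨ y' = y₀ := by
      by_contra h
      rw [if_neg h] at h3
      omega
    rw [if_pos hy'] at h2 h3
    have hy : f.val y ≤ p ∨ y = y₀ := by
      by_contra h
      rw [if_neg h] at h2
      omega
    rw [if_pos hy] at h1 h2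
    rcases Nat.lt_or_ge p (f.val y') with hlt | hge
    · obtain rfl : y' = y₀ := by omega
      rcases hy with hy | rfl
      · obtain ⟨z, hz⟩ := f.exists_val_eq (i := p) (by omega)
        exact (hlow z (by omega) hz).le.trans (hdec y z h1 (by omega) (by omega))
      · exact le_rfl
    · exact hdec y y' h1 h2 hge
  · intro y y' h1 h2
    simp only [val_mk] at h1 h2
    have hy : y = y₀ := by
      split_ifs at h1 <;> omega
    have hy' : y' ≠ y₀ ∧ f.val y' = p + 1 := by
      split_ifs at h2 with h
      · rcases h with h | rfl <;> omega
      · exact ⟨fun h' => h (Or.inr h'), by omega⟩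
    rw [hy]
    exact lt_of_le_of_ne (hmin y' hy'.2) hy'.1.symm
  · refine ext_val fun y => ?_
    simp only [val_face, val_mk]
    by_cases hy : f.val y ≤ p ∨ y = y₀
    · rw [if_pos hy]
      have : f.val y ≤ p + 1 := by rcases hy with h | rfl <;> omega
      unfold mergeVal; split_ifs <;> omega
    · rw [if_neg hy]
      unfold mergeVal; split_ifs <;> omega

lemma card_split_le (hn : 0 < n) (hk : 0 < k) :
    Nat.card {f : StarCell n k m // ∃ p, f.SplitAt p} ≤
      Nat.card {f : StarCell n k (m + 1) // ∃ p, f.AscentAt p} := by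
  choose p hp using fun f : {f : StarCell n k m // ∃ p, f.SplitAt p} => f.2
  choose g hg hgf using fun f => (hp f).exists_ascentAt hn hk
  refine Nat.card_le_card_of_injective (fun f => ⟨g f, p f + 1, hg f⟩) fun f f' h => ?_
  have h1 : g f = g f' := congrArg Subtype.val h
  have h2 : p f = p f' := by
    refine le_antisymm ?_ ?_
    · have := (hg f').le_of_ascentAt (h1 ▸ hg f); omega
    · have := (hg f).le_of_ascentAt (h1 ▸ hg f'); omega
  exact Subtype.ext (by rw [← hgf f, ← hgf f', h1, h2])

lemma DecSingletons.card_filter {f : StarCell n k m} (hf : f.DecSingletons m) {i : ℕ}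
    (hi : i ≤ m) : (Finset.univ.filter fun y => 1 ≤ f.val y ∧ f.val y ≤ i).card = i := by
  rw [← Finset.card_image_of_injOn (f := f.val)]
  · conv_rhs => rw [← Nat.card_Icc 1 i |>.trans (Nat.add_sub_cancel i 1)]
    congr 1
    ext j
    simp only [Finset.mem_image, Finset.mem_filter, Finset.mem_univ, true_and, Finset.mem_Icc]
    constructor
    · rintro ⟨y, hy, rfl⟩
      exact hy
    · intro hj
      obtain ⟨y, rfl⟩ := f.exists_val_eq (i := j) (by omega)
      exact ⟨y, hj, rfl⟩
  · intro y hy y' hy' h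
    simp only [Finset.coe_filter, Finset.mem_univ, true_and, Set.mem_ofPred_eq] at hy hy'
    exact le_antisymm (hf y' y (by omega) (by omega) (by omega))
      (hf y y' (by omega) (by omega) (by omega))

lemma DecSingletons.val_eq_card {f : StarCell n k m} (hf : f.DecSingletons m) {y : Fin n}
    (hy : f.val y ≠ 0) : f.val y = (Finset.univ.filter fun z => f.val z ≠ 0 ∧ y ≤ z).card := by
  have hlt := f.val_lt y
  rw [← hf.card_filter (i := f.val y) (by omega)]
  congr 1
  ext z
  have hlt' := f.val_lt z
  simp only [Finset.mem_filter, Finset.mem_univ, true_and]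
  constructor
  · rintro ⟨h1, h2⟩
    exact ⟨by omega, hf z y h1 h2 (by omega)⟩
  · rintro ⟨h1, h2⟩
    refine ⟨by omega, ?_⟩
    by_contra! h3
    obtain rfl := le_antisymm h2 (hf y z (by omega) h3.le (by omega))
    exact h3.false

lemma card_decSingletons_le (hn : 0 < n) :
    Nat.card {f : StarCell n k m // f.DecSingletons m} ≤ (n - 1).choose m := by
  have hcard : Nat.card (Finset.powersetCard m (Finset.univ.erase (⟨0, hn⟩ : Fin n))) =
      (n - 1).choose m := by
    rw [Nat.card_eq_fintype_card, Fintype.card_coe, Finset.card_powersetCard]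
    simp
  rw [← hcard]
  refine Nat.card_le_card_of_injective
    (fun f => ⟨Finset.univ.filter fun y => f.1.val y ≠ 0, ?_⟩) fun f f' h => ?_
  · rw [Finset.mem_powersetCard]
    constructor
    · intro y hy
      simp only [Finset.mem_filter, Finset.mem_univ, true_and] at hy
      refine Finset.mem_erase.2 ⟨?_, Finset.mem_univ _⟩
      rintro rfl
      exact hy (f.1.val_of_eq_zero rfl)
    · refine Eq.trans ?_ (f.2.card_filter le_rfl)
      congr 1
      ext y
      have := f.1.val_lt y
      simp only [Finset.mem_filter, Finset.mem_univ, true_and]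
      omega
  · have h1 (y : Fin n) : f.1.val y ≠ 0 ↔ f'.1.val y ≠ 0 := by
      have := Finset.ext_iff.1 (congrArg Subtype.val h) y
      simpa only [Finset.mem_filter, Finset.mem_univ, true_and] using this
    refine Subtype.ext (ext_val fun y => ?_)
    by_cases hy : f.1.val y = 0
    · rw [hy]
      by_contra hy'
      exact (h1 y).2 (Ne.symm hy') hy
    · rw [f.2.val_eq_card hy, f'.2.val_eq_card ((h1 y).1 hy)]
      simp only [h1]

lemma card_le_add (hn : 0 < n) (hk : 0 < k) :
    Fintype.card (StarCell n k m) ≤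
      Nat.card {f : StarCell n k m // ∃ p, f.AscentAt p} +
      (Nat.card {f : StarCell n k (m + 1) // ∃ p, f.AscentAt p} + (n - 1).choose m) := by
  classical
  calc Fintype.card (StarCell n k m)
      = Fintype.card {f : StarCell n k m //
          (∃ p, f.AscentAt p) ∨ (∃ p, f.SplitAt p) ∨ f.DecSingletons m} :=
        (Fintype.card_of_subtype Finset.univ (by simp [ascentAt_or_splitAt_or])).symm
    _ ≤ Nat.card {f : StarCell n k m // ∃ p, f.AscentAt p} +
          (Nat.card {f : StarCell n k m // ∃ p, f.SplitAt p} +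
            Nat.card {f : StarCell n k m // f.DecSingletons m}) := by
        simp only [Nat.card_eq_fintype_card]
        exact (Fintype.card_subtype_or _ _).trans
          (Nat.add_le_add_left (Fintype.card_subtype_or _ _) _)
    _ ≤ _ := Nat.add_le_add_left (Nat.add_le_add (card_split_le hn hk)
        (card_decSingletons_le hn)) _

end StarCell

/-- The signed count of the ways in which `f ∘ t` is a bijection onto `{1, …, m}`. -/
noncomputable def altCount {n m : ℕ} (t : Fin m → Fin n) (f : Fin n → ℕ) : ℚ :=
  Matrix.det (Matrix.of fun a b : Fin m => if f (t a) = b + 1 then (1 : ℚ) else 0)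

/-- The signed count of the ways in which `f ∘ t` is a bijection onto `{1, …, m + 1} \ {i + 1}`. -/
noncomputable def altCountOmit {n m : ℕ} (t : Fin m → Fin n) (f : Fin n → ℕ) (i : ℕ) : ℚ :=
  Matrix.det (Matrix.of fun a b : Fin m =>
    if f (t a) = (if (b : ℕ) < i then (b : ℕ) + 1 else b + 2) then (1 : ℚ) else 0)

lemma altCount_mergeVal_zero {n m : ℕ} (t : Fin m → Fin n) (f : Fin n → ℕ) :
    altCount t (fun y => mergeVal (m + 1) 0 (f y)) = altCountOmit t f 0 := by
  unfold altCount altCountOmit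
  congr 1
  ext a b
  simp only [Matrix.of_apply]
  refine if_congr ?_ rfl rfl
  unfold mergeVal; split_ifs <;> constructor <;> intro h <;> omega

lemma altCount_mergeVal_last {n m : ℕ} (t : Fin m → Fin n) (f : Fin n → ℕ) :
    altCount t (fun y => mergeVal (m + 1) (m + 1) (f y)) = altCountOmit t f m := by
  unfold altCount altCountOmit
  congr 1
  ext a b
  have := b.isLt
  simp only [Matrix.of_apply]
  refine if_congr ?_ rfl rfl
  unfold mergeVal; split_ifs <;> constructor <;> intro h <;> first | omega | exact h.elim

lemma altCount_mergeVal_succ {n m : ℕ} (t : Fin m → Fin n) (f : Fin n → ℕ) {i : ℕ} (hi : i < m) :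
    altCount t (fun y => mergeVal (m + 1) (i + 1) (f y)) =
      altCountOmit t f i + altCountOmit t f (i + 1) := by
  set M : Matrix (Fin m) (Fin m) ℚ :=
    Matrix.of fun a b => if mergeVal (m + 1) (i + 1) (f (t a)) = b + 1 then 1 else 0 with hM
  have h := Matrix.det_updateCol_add M ⟨i, hi⟩ (fun a => if f (t a) = i + 2 then 1 else 0)
    (fun a => if f (t a) = i + 1 then 1 else 0)
  have key (u : Fin m → ℚ) (a b : Fin m) :
      M.updateCol ⟨i, hi⟩ u a b = if (b : ℕ) = i then u a else
        if mergeVal (m + 1) (i + 1) (f (t a)) = b + 1 then 1 else 0 := by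
    simp [Matrix.updateCol_apply, hM, Fin.ext_iff]
  convert h using 2
  · unfold altCount
    congr 1
    ext a b
    rw [key]
    simp only [Matrix.of_apply, Pi.add_apply]
    by_cases hb : (b : ℕ) = i
    · rw [if_pos hb]
      unfold mergeVal
      split_ifs <;> first | omega | norm_num
    · rw [if_neg hb]
  · unfold altCountOmit
    congr 1
    ext a b
    rw [key]
    simp only [Matrix.of_apply]
    unfold mergeVal
    have := b.isLt
    split_ifs <;> first | omega | rfl
  · unfold altCountOmit
    congr 1
    ext a b
    rw [key]
    simp only [Matrix.of_apply]
    unfold mergeVal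
    have := b.isLt
    split_ifs <;> first | omega | rfl

lemma sum_altCount_mergeVal {n m : ℕ} (t : Fin m → Fin n) (f : Fin n → ℕ) :
    ∑ j ∈ Finset.range (m + 2), (-1 : ℚ) ^ j * altCount t (fun y => mergeVal (m + 1) j (f y))
      = 0 := by
  rw [Finset.sum_range_succ, Finset.sum_range_succ', altCount_mergeVal_zero,
    altCount_mergeVal_last]
  have key (l : ℕ) (hl : l ≤ m) : ∑ i ∈ Finset.range l, (-1 : ℚ) ^ (i + 1) *
      altCount t (fun y => mergeVal (m + 1) (i + 1) (f y)) =
      (-1) ^ l * altCountOmit t f l - altCountOmit t f 0 := by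
    induction l with
    | zero => simp
    | succ l ih =>
      rw [Finset.sum_range_succ, ih (by omega), altCount_mergeVal_succ t f (by omega)]
      ring
  rw [key m le_rfl]
  ring

lemma altCount_perm {n m : ℕ} (t : Fin m → Fin n) (f f' : Fin n → ℕ) (τ : Equiv.Perm (Fin m))
    (hf : ∀ y b, f' y = (τ b : ℕ) + 1 ↔ f y = (b : ℕ) + 1) :
    altCount t f' = (Equiv.Perm.sign τ : ℤ) * altCount t f := by
  unfold altCount
  have h := Matrix.det_permute' τ
    (Matrix.of fun a b : Fin m => if f' (t a) = b + 1 then (1 : ℚ) else 0)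
  have h2 : (Matrix.of fun a b : Fin m => if f' (t a) = b + 1 then (1 : ℚ) else 0).submatrix id τ =
      Matrix.of fun a b : Fin m => if f (t a) = b + 1 then (1 : ℚ) else 0 := by
    ext a b
    simp [hf]
  rw [h2] at h
  rw [h, ← mul_assoc]
  have : ((Equiv.Perm.sign τ : ℤ) : ℚ) * ((Equiv.Perm.sign τ : ℤ) : ℚ) = 1 := by
    rcases Int.units_eq_one_or (Equiv.Perm.sign τ) with h | h <;> simp [h]
  rw [this, one_mul]

lemma altCount_eq_zero {n m : ℕ} {t : Fin m → Fin n} {f : Fin n → ℕ} {a : Fin m}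
    (ha : f (t a) = 0) : altCount t f = 0 :=
  Matrix.det_eq_zero_of_row_eq_zero a fun b => by simp [ha]

namespace StarCell

variable {n k m : ℕ}

/-- The alternating functional of `t`. -/
noncomputable def alt (t : Fin m → Fin n) (f : StarCell n k m) : ℚ := altCount t f.val

open Classical in
/-- The alternating cycle of `t`. -/
noncomputable def cycle (t : Fin m → Fin n) (f : StarCell n k m) : ℚ :=
  if ∀ y, y ∉ Set.range t → f.val y = 0 then f.alt t else 0

lemma sum_cycMat_mul_alt (t : Fin m → Fin n) (f : StarCell n k (m + 1)) :
    ∑ g, cycMat n (starIn n k) (m + 1) f g * alt t g = 0 := by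
  rw [sum_cycMat_mul]
  exact sum_altCount_mergeVal t f.val

/-- The action on block indices of a permutation of the blocks other than the first. -/
def permuteVal (τ : Equiv.Perm (Fin m)) : Equiv.Perm (Fin (m + 1)) :=
  Equiv.Perm.decomposeFin.symm (0, τ)

lemma permuteVal_zero (τ : Equiv.Perm (Fin m)) : permuteVal τ 0 = 0 := by
  simp [permuteVal]

lemma permuteVal_succ (τ : Equiv.Perm (Fin m)) (b : Fin m) : permuteVal τ b.succ = (τ b).succ := by
  simp [permuteVal]

lemma permuteVal_eq_zero {τ : Equiv.Perm (Fin m)} {x : Fin (m + 1)} :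
    permuteVal τ x = 0 ↔ x = 0 := by
  conv_lhs => rw [← permuteVal_zero τ, (permuteVal τ).apply_eq_iff_eq]

/-- Permuting the blocks other than the first. -/
def permuteFun (σ : Equiv.Perm (Fin (m + 1))) (hσ : σ 0 = 0) (f : StarCell n k m) :
    StarCell n k m :=
  ⟨fun y => σ (f.1 y), σ.surjective.comp f.2.1,
    fun y hy => by
      have h : f.1 y = 0 := Fin.ext (f.2.2.1 y hy)
      exact congrArg Fin.val ((congrArg σ h).trans hσ),
    by
      obtain ⟨e, h1, h2, i, h3⟩ := f.2.2.2
      exact ⟨e, h1, h2, σ i, fun x hx => congrArg σ (h3 x hx)⟩⟩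

/-- Permuting the blocks other than the first, as a permutation of the cells. -/
def permute (τ : Equiv.Perm (Fin m)) : Equiv.Perm (StarCell n k m) where
  toFun := permuteFun (permuteVal τ) (permuteVal_zero τ)
  invFun := permuteFun (permuteVal τ).symm
    ((permuteVal τ).symm_apply_eq.2 (permuteVal_zero τ).symm)
  left_inv _ := Subtype.ext (funext fun _ => (permuteVal τ).symm_apply_apply _)
  right_inv _ := Subtype.ext (funext fun _ => (permuteVal τ).apply_symm_apply _)

lemma val_permute_eq_zero (τ : Equiv.Perm (Fin m)) (f : StarCell n k m) (y : Fin n) :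
    (permute τ f).val y = 0 ↔ f.val y = 0 := by
  have h := permuteVal_eq_zero (τ := τ) (x := f.1 y)
  rw [Fin.ext_iff, Fin.ext_iff] at h
  exact h

lemma val_permute_eq_succ (τ : Equiv.Perm (Fin m)) (f : StarCell n k m) (y : Fin n) (b : Fin m) :
    (permute τ f).val y = (τ b : ℕ) + 1 ↔ f.val y = (b : ℕ) + 1 := by
  have h : permuteVal τ (f.1 y) = (τ b).succ ↔ f.1 y = b.succ := by
    rw [← permuteVal_succ, (permuteVal τ).apply_eq_iff_eq]
  rw [Fin.ext_iff, Fin.ext_iff] at h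
  exact h

lemma cycle_permute (t : Fin m → Fin n) (τ : Equiv.Perm (Fin m)) (f : StarCell n k m) :
    cycle t (permute τ f) = (Equiv.Perm.sign τ : ℤ) * cycle t f := by
  unfold cycle
  simp only [val_permute_eq_zero, alt]
  split_ifs
  · exact altCount_perm t _ _ τ fun y b => val_permute_eq_succ τ f y b
  · simp

lemma sum_cycle_mul_face (t : Fin (m + 1) → Fin n) (τ : Equiv.Perm (Fin (m + 1))) {i j : ℕ}
    (hτ : ∀ b : Fin (m + 1), mergeVal (m + 1) i (τ b + 1) = mergeVal (m + 1) j (b + 1))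
    (h : StarCell n k m) :
    ∑ f, cycle t f * (if f.face j = h then 1 else 0) =
      (Equiv.Perm.sign τ : ℤ) * ∑ f, cycle t f * (if f.face i = h then 1 else 0) := by
  rw [← Equiv.sum_comp (permute τ) fun f : StarCell n k (m + 1) =>
    cycle t f * (if f.face i = h then 1 else 0), Finset.mul_sum]
  refine Finset.sum_congr rfl fun f _ => ?_
  have hface : (permute τ f).face i = f.face j := by
    refine ext_val fun y => ?_
    simp only [val_face]
    by_cases hy : f.val y = 0
    · rw [(val_permute_eq_zero τ f y).2 hy, hy, mergeVal_zero, mergeVal_zero]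
    · have hlt := f.val_lt y
      have hb : f.val y = ((⟨f.val y - 1, by omega⟩ : Fin (m + 1)) : ℕ) + 1 := by
        dsimp only; omega
      rw [(val_permute_eq_succ τ f y _).2 hb, hτ, ← hb]
  rw [hface, cycle_permute, ← mul_assoc, ← mul_assoc]
  congr 1
  rcases Int.units_eq_one_or (Equiv.Perm.sign τ) with h | h <;> simp [h]

lemma sum_cycle_mul_face_succ (t : Fin (m + 1) → Fin n) {i : ℕ} (hi : i < m)
    (h : StarCell n k m) : ∑ f, cycle t f * (if f.face (i + 1) = h then 1 else 0) = 0 := by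
  have key := sum_cycle_mul_face t
    (Equiv.swap (⟨i, by omega⟩ : Fin (m + 1)) ⟨i + 1, by omega⟩) (i := i + 1) (j := i + 1)
    (fun b => by
      by_cases h1 : b = ⟨i, by omega⟩
      · rw [h1, Equiv.swap_apply_left]
        unfold mergeVal; dsimp only; split_ifs <;> omega
      by_cases h2 : b = ⟨i + 1, by omega⟩
      · rw [h2, Equiv.swap_apply_right]
        unfold mergeVal; dsimp only; split_ifs <;> omega
      · rw [Equiv.swap_apply_of_ne_of_ne h1 h2]) h
  rw [Equiv.Perm.sign_swap (by simp [Fin.ext_iff])] at key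
  push_cast at key
  linarith

lemma sum_cycle_mul_face_zero (t : Fin (m + 1) → Fin n) (h : StarCell n k m) :
    ∑ f, cycle t f * (if f.face 0 = h then 1 else 0) =
      (-1) ^ m * ∑ f, cycle t f * (if f.face (m + 1) = h then 1 else 0) := by
  rw [sum_cycle_mul_face t (finRotate (m + 1)).symm (i := m + 1) (j := 0) ?_ h,
    Equiv.Perm.sign_symm, sign_finRotate]
  · push_cast; rfl
  · intro b
    obtain ⟨c, rfl⟩ := (finRotate (m + 1)).surjective b
    rw [Equiv.symm_apply_apply, coe_finRotate]
    have := c.isLt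
    by_cases hc : c = Fin.last m
    · rw [if_pos hc, hc]
      unfold mergeVal; simp
    · rw [if_neg hc]
      have : (c : ℕ) ≠ m := fun h' => hc (Fin.ext h')
      unfold mergeVal; split_ifs <;> omega

lemma cycBnd_cycle (t : Fin m → Fin n) (hn : 0 < n) :
    cycBnd n (starIn n k) m (cycle t) = 0 := by
  cases m with
  | zero => exact funext fun h => (h.1 ⟨0, hn⟩).elim0
  | succ m =>
    refine funext fun h => ?_
    change ∑ f, cycle t f * cycMat n (starIn n k) (m + 1) f h = 0
    simp only [cycMat_eq, Finset.mul_sum]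
    rw [Finset.sum_comm]
    have hrw (j : ℕ) : ∑ f : StarCell n k (m + 1),
        cycle t f * ((-1) ^ j * (if f.face j = h then 1 else 0)) =
        (-1) ^ j * ∑ f, cycle t f * (if f.face j = h then 1 else 0) := by
      rw [Finset.mul_sum]
      exact Finset.sum_congr rfl fun f _ => by ring
    simp only [hrw]
    rw [Finset.sum_range_succ, Finset.sum_range_succ', Finset.sum_eq_zero fun i hi => by
      rw [sum_cycle_mul_face_succ t (Finset.mem_range.1 hi) h, mul_zero],
      sum_cycle_mul_face_zero]
    ring

lemma sum_cycle_mul_alt_of_not_subset {t t' : Fin m → Fin n} (h : ¬ Set.range t' ⊆ Set.range t) :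
    ∑ f : StarCell n k m, cycle t f * f.alt t' = 0 := by
  refine Finset.sum_eq_zero fun f _ => ?_
  obtain ⟨_, ⟨a, rfl⟩, ha⟩ := Set.not_subset.1 h
  unfold cycle
  split_ifs with hf
  · rw [alt, alt, altCount_eq_zero (t := t') (hf _ ha), mul_zero]
  · exact zero_mul _

lemma sum_cycle_mul_alt_self_pos (hn : 0 < n) (hk : 0 < k) (hkm : m + k ≤ n) {t : Fin m → Fin n}
    (ht : Injective t) (ht0 : ∀ a, (t a : ℕ) ≠ 0) :
    0 < ∑ f : StarCell n k m, cycle t f * f.alt t := by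
  classical
  let v : Fin n → ℕ := fun y => if h : ∃ a, t a = y then (h.choose : ℕ) + 1 else 0
  have hvt (a : Fin m) : v (t a) = a + 1 := by
    have h : ∃ a', t a' = t a := ⟨a, rfl⟩
    simp only [v, dif_pos h, ht h.choose_spec]
  have hv0 (y : Fin n) (hy : y ∉ Set.range t) : v y = 0 := dif_neg hy
  let f₀ : StarCell n k m := mk v
    (fun y => by
      by_cases hy : y ∈ Set.range t
      · obtain ⟨a, rfl⟩ := hy
        rw [hvt]; omega
      · rw [hv0 y hy]; omega)
    (fun i hi => by
      cases i with
      | zero => exact ⟨⟨0, hn⟩, hv0 _ fun ⟨a, ha⟩ => ht0 a (by rw [ha])⟩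
      | succ i => exact ⟨t ⟨i, by omega⟩, hvt _⟩)
    (fun y hy => hv0 y fun ⟨a, ha⟩ => ht0 a (by rw [ha, hy])) hn
    (by
      have h1 : (Finset.univ.image t)ᶜ ⊆ Finset.univ.filter fun y => v y = 0 := by
        intro y hy
        simpa using hv0 y (by simpa using hy)
      refine le_trans ?_ (Finset.card_le_card h1)
      rw [Finset.card_compl, Finset.card_image_of_injective _ ht]
      simp only [Fintype.card_fin, Finset.card_univ]
      omega) hk
  have halt : f₀.alt t = 1 := by
    rw [alt, altCount, ← Matrix.det_one (n := Fin m)]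
    congr 1
    ext a b
    simp [f₀, hvt, Matrix.one_apply, Fin.ext_iff]
  refine Finset.sum_pos' (fun f _ => ?_) ⟨f₀, Finset.mem_univ _, ?_⟩
  · unfold cycle
    split_ifs
    · exact mul_self_nonneg _
    · simp
  · rw [cycle, if_pos (show ∀ y, y ∉ Set.range t → f₀.val y = 0 from hv0), halt]
    norm_num

lemma choose_add_finrank_range_le (hn : 0 < n) (hk : 0 < k) (hkm : m + k ≤ n) :
    (n - 1).choose m + Module.finrank ℚ (LinearMap.range (cycBnd n (starIn n k) (m + 1))) ≤
      Module.finrank ℚ (LinearMap.ker (cycBnd n (starIn n k) m)) := by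
  classical
  set I := Finset.powersetCard m (Finset.univ.erase (⟨0, hn⟩ : Fin n)) with hI
  have hcard : Fintype.card I = (n - 1).choose m := by
    rw [Fintype.card_coe, hI, Finset.card_powersetCard]
    simp
  have hIcard (S : I) : S.1.card = m := (Finset.mem_powersetCard.1 S.2).2
  let t (S : I) : Fin m → Fin n := S.1.orderEmbOfFin (hIcard S)
  have ht (S : I) : Set.range (t S) = S.1 := Finset.range_orderEmbOfFin _ _
  let A : (StarCell n k m → ℚ) →ₗ[ℚ] (I → ℚ) := matLin fun f S => f.alt (t S)
  have hA (c : StarCell n k m → ℚ) (S : I) : A c S = ∑ f, c f * f.alt (t S) := rfl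
  have hcycle (S : I) : A (cycle (t S)) =
      Pi.single S (∑ f : StarCell n k m, cycle (t S) f * f.alt (t S)) := by
    ext T
    rw [hA]
    by_cases hTS : T = S
    · subst hTS; simp
    · rw [Pi.single_eq_of_ne hTS]
      refine sum_cycle_mul_alt_of_not_subset fun hsub => hTS (Subtype.ext ?_)
      rw [ht, ht, Finset.coe_subset] at hsub
      exact Finset.eq_of_subset_of_card_le hsub (by rw [hIcard, hIcard])
  set K := LinearMap.ker (cycBnd n (starIn n k) m) with hK
  have hsurj : LinearMap.range (A.domRestrict K) = ⊤ := by
    rw [eq_top_iff, ← (Pi.basisFun ℚ I).span_eq, Submodule.span_le]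
    rintro _ ⟨S, rfl⟩
    have hpos : 0 < ∑ f : StarCell n k m, cycle (t S) f * f.alt (t S) := by
      refine sum_cycle_mul_alt_self_pos hn hk hkm (S.1.orderEmbOfFin (hIcard S)).injective
        fun a ha => ?_
      have hmem := (Finset.mem_powersetCard.1 S.2).1 (S.1.orderEmbOfFin_mem (hIcard S) a)
      exact (Finset.mem_erase.1 hmem).1 (Fin.ext ha)
    refine ⟨⟨(∑ f : StarCell n k m, cycle (t S) f * f.alt (t S))⁻¹ • cycle (t S),
      K.smul_mem _ (LinearMap.mem_ker.2 (cycBnd_cycle (t S) hn))⟩, ?_⟩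
    rw [LinearMap.domRestrict_apply, map_smul, hcycle, ← Pi.single_smul, smul_eq_mul,
      inv_mul_cancel₀ hpos.ne', Pi.basisFun_apply]
  have hrank := LinearMap.finrank_range_add_finrank_ker (A.domRestrict K)
  rw [hsurj, finrank_top, Module.finrank_fintype_fun_eq_card, hcard] at hrank
  rw [← hrank]
  refine Nat.add_le_add_left ?_ _
  rw [LinearMap.ker_domRestrict, ← (Submodule.comapSubtypeEquivOfLe (p := LinearMap.range
    (cycBnd n (starIn n k) (m + 1))) (q := K) ?_).finrank_eq]
  · refine Submodule.finrank_mono (Submodule.comap_mono ?_)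
    rintro _ ⟨c, rfl⟩
    refine LinearMap.mem_ker.2 (funext fun S => ?_)
    rw [hA]
    change ∑ g, (∑ f, c f * cycMat n (starIn n k) (m + 1) f g) * alt (t S) g = 0
    simp only [Finset.sum_mul, mul_assoc]
    rw [Finset.sum_comm]
    refine Finset.sum_eq_zero fun f _ => ?_
    rw [← Finset.mul_sum, sum_cycMat_mul_alt, mul_zero]
  · exact LinearMap.range_le_ker_iff.2 (cycBnd_comp hn k m)

end StarCell

lemma finrank_homologyOf {A B C : Type} [AddCommGroup A] [AddCommGroup B] [AddCommGroup C]
    [Module ℚ A] [Module ℚ B] [Module ℚ C] [FiniteDimensional ℚ B] (d₂ : A →ₗ[ℚ] B)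
    (d₁ : B →ₗ[ℚ] C) (h : d₁ ∘ₗ d₂ = 0) :
    Module.finrank ℚ (homologyOf d₂ d₁) + Module.finrank ℚ (LinearMap.range d₂) =
      Module.finrank ℚ (LinearMap.ker d₁) := by
  rw [← Submodule.finrank_quotient_add_finrank
    ((LinearMap.range d₂).comap (LinearMap.ker d₁).subtype),
    (Submodule.comapSubtypeEquivOfLe (LinearMap.range_le_ker_iff.2 h)).finrank_eq]

/-- Theorem (paper Thm. `Vertex1Hypergraph`): for the `k`-uniform star hypergraph `H` at the
vertex `1` on `n` vertices (`3 ≤ k ≤ n-1`), `HC_r(Δ(H))` is nonzero exactly for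
`-1 ≤ r ≤ n-k-1`, where it has dimension `C(n-1, r+1)`.  Below `m = r + 1`, so homological
degree `r` corresponds to partitions with `m + 1` blocks; the claim for `m > n - k`
(including all degrees above the dimension of the complex) is that the homology vanishes,
and for `m ≤ n - k` the dimension is the (automatically nonzero) binomial coefficient. -/
theorem dim_HC_cyclic_star (n k : ℕ) (hk : 3 ≤ k) (hkn : k ≤ n - 1) :
    ∀ m : ℕ, Module.finrank ℚ (homologyOf (cycBnd n (starIn n k) (m + 1))
      (cycBnd n (starIn n k) m)) = if m ≤ n - k then Nat.choose (n - 1) m else 0 := by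
  have hn : 0 < n := by omega
  intro m
  have hH := finrank_homologyOf _ _ (cycBnd_comp hn k m)
  split_ifs with hm
  · have h1 := StarCell.card_ascent_le_finrank_range n k m
    have h2 := StarCell.card_ascent_le_finrank_range n k (m + 1)
    have h3 := StarCell.card_le_add (m := m) hn (show 0 < k by omega)
    have h4 := StarCell.choose_add_finrank_range_le (m := m) (k := k) hn (by omega) (by omega)
    have h5 := LinearMap.finrank_range_add_finrank_ker (cycBnd n (starIn n k) m)
    rw [Module.finrank_fintype_fun_eq_card] at h5
    change _ = Fintype.card (StarCell n k m) at h5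
    omega
  · have := StarCell.isEmpty (k := k) (m := m) hn (by omega)
    have h5 := LinearMap.finrank_range_add_finrank_ker (cycBnd n (starIn n k) m)
    rw [Module.finrank_fintype_fun_eq_card, Fintype.card_eq_zero] at h5
    omega
end

section
/- Let 3 ≤ k ≤ n−1 and let H be the k-uniform hypergraph on {1,...,n} whose hyperedges are all k-element subsets of {1,...,n} containing the vertex 1, and let −1 ≤ r ≤ n−k−1. For each subset A ⊆ {2,...,n} with |A| = n−r−2, let a_1 < a_2 < ... < a_{r+1} be the elements of {2,...,n} \ A and set z_A = Σ_{σ ∈ S_{r+1}} sgn(σ) [A ∪ {1}, {a_{σ(1)}}, ..., {a_{σ(r+1)}}]. Then each z_A is a cycle of the chain complex Δ(H), and the homology classes [z_A], as A ranges over all (n−r−2)-element subsets of {2,...,n}, form a basis of HC_r(Δ(H)). -/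
open Function

/-- The cycle `z_A` of the proof of paper Thm. `Vertex1Hypergraph`: given a set `A` of
vertices not containing the vertex `1`, with complement (inside the non-`1` vertices)
enumerated increasingly by `av : Fin q → Fin n`,
`z_A = Σ_{σ ∈ S_q} sgn(σ) [A ∪ {1}, {a_{σ(1)}}, …, {a_{σ(q)}}]`,
an element of the degree-`(q-1)` chain group of `Δ(H)` (partitions with `q+1` blocks).
The class `[A ∪ {1}, {a_{σ(1)}}, …]` is encoded by the conditions that all elements of
`A ∪ {1}` lie in block `0` and `a_{σ(t)}` lies in block `t+1`. -/
def zChain (n k q : ℕ) (A : Finset (Fin n)) (av : Fin q → Fin n) :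
    CycBas n (starIn n k) (q + 1) → ℚ := fun g =>
  ∑ σ : Equiv.Perm (Fin q),
    if (∀ x : Fin n, (x ∈ A ∨ (x : ℕ) = 0) → (g.1 x : ℕ) = 0) ∧
       (∀ t : Fin q, (g.1 (av (σ t)) : ℕ) = (t : ℕ) + 1)
    then ((Equiv.Perm.sign σ : ℤ) : ℚ) else 0

section Matching

variable {X Y : Type} [Fintype X]

lemma matLin_apply (M : X → Y → ℚ) (c : X → ℚ) (b : Y) :
    matLin M c b = ∑ a, c a * M a b := rfl

lemma matLin_single [DecidableEq X] (M : X → Y → ℚ) (a : X) (b : Y) :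
    matLin M (Pi.single a 1) b = M a b := by
  simp [matLin_apply, Pi.single_apply]

/-- Along an acyclic matching `R`, every chain is homologous to a chain vanishing on all
lower matched cells. -/
lemma exists_sub_matLin_eq_zero [Fintype Y] (M : X → Y → ℚ) (R : Y → X → Prop) (τ : Y → ℕ)
    (hdiag : ∀ f h, R f h → M h f ≠ 0)
    (hlt : ∀ f h f' h', R f h → R f' h' → f' ≠ f → M h f' ≠ 0 → τ f < τ f') (c : Y → ℚ) :
    ∃ w, ∀ f h, R f h → (c - matLin M w) f = 0 := by
  classical
  have key : ∀ t : ℕ, ∃ w, ∀ f h, R f h → τ f < t → (c - matLin M w) f = 0 := by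
    intro t
    induction t with
    | zero => exact ⟨0, fun f h _ ht => absurd ht (Nat.not_lt_zero _)⟩
    | succ t ih =>
      obtain ⟨w, hw⟩ := ih
      have : ∃ u : Y → (X → ℚ), ∀ f, (∀ h, R f h → ∃ h', R f h' ∧ u f = Pi.single h' 1) := by
        refine ⟨fun f => if h : ∃ h, R f h then Pi.single h.choose 1 else 0, fun f h hf => ?_⟩
        have hex : ∃ h, R f h := ⟨h, hf⟩
        exact ⟨hex.choose, hex.choose_spec, dif_pos hex⟩
      obtain ⟨u, hu⟩ := this
      refine ⟨w + ∑ f ∈ Finset.univ.filter (fun f => (∃ h, R f h) ∧ τ f = t),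
        ((c - matLin M w) f / matLin M (u f) f) • u f, fun f' h' hf' ht' => ?_⟩
      simp only [map_add, map_sum, map_smul, Pi.sub_apply, Pi.add_apply, Finset.sum_apply,
        Pi.smul_apply, smul_eq_mul]
      have hne : ∀ f ∈ Finset.univ.filter (fun f => (∃ h, R f h) ∧ τ f = t), f ≠ f' →
          ((c f - matLin M w f) / matLin M (u f) f) * matLin M (u f) f' = 0 := by
        intro f hf hff
        obtain ⟨-, ⟨h, hR⟩, hτ⟩ := Finset.mem_filter.mp hf
        obtain ⟨h₁, hR₁, hu₁⟩ := hu f h hR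
        have : M h₁ f' = 0 := by
          by_contra hM
          have := hlt f h₁ f' h' hR₁ hf' hff.symm hM
          omega
        rw [hu₁, matLin_single M h₁ f', this, mul_zero]
      by_cases hτ : τ f' = t
      · rw [Finset.sum_eq_single f' hne (fun hn => absurd (Finset.mem_filter.mpr
          ⟨Finset.mem_univ _, ⟨h', hf'⟩, hτ⟩) hn)]
        obtain ⟨h₁, hR₁, hu₁⟩ := hu f' h' hf'
        have := hdiag f' h₁ hR₁
        rw [hu₁, matLin_single]
        field_simp
        ring
      · rw [Finset.sum_eq_zero]
        · have := hw f' h' hf' (by omega)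
          simpa using this
        · intro f hf
          exact hne f hf (fun h => hτ (h ▸ (Finset.mem_filter.mp hf).2.2))
  obtain ⟨w, hw⟩ := key (Finset.univ.sup τ + 1)
  exact ⟨w, fun f h hf => hw f h hf (Nat.lt_succ_of_le (Finset.le_sup (Finset.mem_univ f)))⟩

/-- Along an acyclic matching `R`, a chain supported on upper matched cells whose boundary
vanishes on the lower matched cells is zero. -/
lemma eq_zero_of_matLin_eq_zero (M : X → Y → ℚ) (R : Y → X → Prop) (τ : Y → ℕ)
    (hdiag : ∀ f h, R f h → M h f ≠ 0)
    (hlt : ∀ f h f' h', R f h → R f' h' → f' ≠ f → M h f' ≠ 0 → τ f < τ f')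
    (hfun : ∀ f g h, R f g → R f h → g = h) (c : X → ℚ)
    (hc : ∀ f h, R f h → matLin M c f = 0) (hsupp : ∀ g, c g ≠ 0 → ∃ f, R f g) : c = 0 := by
  classical
  have key : ∀ t : ℕ, ∀ f h, R f h → τ f = t → c h = 0 := by
    intro t
    induction t using Nat.strong_induction_on with
    | _ t ih =>
      intro f h hf ht
      have h0 := hc f h hf
      rw [matLin_apply, Finset.sum_eq_single h] at h0
      · exact (mul_eq_zero.mp h0).resolve_right (hdiag f h hf)
      · intro g _ hg
        by_contra hne
        obtain ⟨f', hf'⟩ := hsupp g (left_ne_zero_of_mul hne)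
        by_cases hff : f = f'
        · subst hff
          exact hg (hfun f g h hf' hf)
        · have := hlt f' g f h hf' hf hff (right_ne_zero_of_mul hne)
          exact left_ne_zero_of_mul hne (ih _ (by omega) f' g hf' rfl)
      · simp
  funext g
  by_contra hne
  obtain ⟨f, hf⟩ := hsupp g hne
  exact hne (key _ f g hf rfl)

end Matching

section Pivot

variable {n : ℕ}

/-- The label of `x` is nonzero and not smaller than the nonzero label of some later vertex. -/
def IsBad (F : Fin n → ℕ) (x : Fin n) : Prop :=
  F x ≠ 0 ∧ ∃ y, x < y ∧ F y ≠ 0 ∧ F y ≤ F x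

/-- The first bad vertex. -/
def IsPivot (F : Fin n → ℕ) (x : Fin n) : Prop :=
  IsBad F x ∧ ∀ y < x, ¬ IsBad F y

lemma IsPivot.unique {F : Fin n → ℕ} {x y : Fin n} (hx : IsPivot F x) (hy : IsPivot F y) :
    x = y := by
  rcases lt_trichotomy x y with h | h | h
  · exact absurd hx.1 (hy.2 x h)
  · exact h
  · exact absurd hy.1 (hx.2 y h)

lemma exists_isPivot {F : Fin n → ℕ} (h : ∃ x, IsBad F x) : ∃ x, IsPivot F x := by
  classical
  obtain ⟨x, hx, hmin⟩ := (Finset.univ.filter (IsBad F)).exists_minimal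
    (by obtain ⟨x, hx⟩ := h; exact ⟨x, by simpa using hx⟩)
  refine ⟨x, by simpa using hx, fun y hy hb => ?_⟩
  exact absurd (hmin (by simpa using hb) hy.le) (not_le.mpr hy)

/-- `G` arises from `F` by splitting the block of the pivot `x` of `F`, which must contain a
later vertex, into the block without `x` followed by the singleton `{x}`. -/
def IsMatched (F G : Fin n → ℕ) : Prop :=
  ∃ x, IsPivot F x ∧ (∃ y, x < y ∧ F y = F x) ∧
    ∀ w, G w = if w = x then F x + 1 else if F w ≤ F x then F w else F w + 1

lemma IsMatched.unique {F G G' : Fin n → ℕ} (h : IsMatched F G) (h' : IsMatched F G') :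
    G = G' := by
  obtain ⟨x, hx, -, hG⟩ := h
  obtain ⟨x', hx', -, hG'⟩ := h'
  obtain rfl := hx.unique hx'
  exact funext fun w => (hG w).trans (hG' w).symm

lemma IsMatched.not_injOn {F G : Fin n → ℕ} (h : IsMatched F G) :
    ∃ x y, x ≠ y ∧ F x ≠ 0 ∧ F x = F y := by
  obtain ⟨x, hx, ⟨y, hy, hxy⟩, -⟩ := h
  exact ⟨x, y, hy.ne, hx.1.1, hxy.symm⟩

/-- The number of vertices labelled `0`. -/
def zeroCount (F : Fin n → ℕ) : ℕ := (Finset.univ.filter fun x => F x = 0).card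

/-- The rank function witnessing acyclicity of the matching: lexicographic in the number of
zero labels, the (reversed) pivot and the label of the pivot. -/
noncomputable def rank (N : ℕ) (F : Fin n → ℕ) : ℕ := by
  classical
  exact if h : ∃ x, IsPivot F x then
    (zeroCount F * (n + 1) + (n - h.choose)) * N + F h.choose else 0

lemma rank_eq {N : ℕ} {F : Fin n → ℕ} {x : Fin n} (hx : IsPivot F x) :
    rank N F = (zeroCount F * (n + 1) + (n - x)) * N + F x := by
  have h : ∃ x, IsPivot F x := ⟨x, hx⟩
  rw [rank, dif_pos h, h.choose_spec.unique hx]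

lemma rank_lt {N : ℕ} {F G : Fin n → ℕ} {x y : Fin n} (hx : IsPivot F x) (hy : IsPivot G y)
    (hN : F x < N) (h : zeroCount F < zeroCount G ∨ zeroCount F = zeroCount G ∧
      (y < x ∨ x = y ∧ F x < G y)) : rank N F < rank N G := by
  rw [rank_eq hx, rank_eq hy]
  have aux : ∀ a b c d : ℕ, a < b → c < N → a * N + c < b * N + d := by
    intro a b c d hab hc
    have : (a + 1) * N ≤ b * N := Nat.mul_le_mul_right _ hab
    linarith
  have hxn := x.isLt
  have hyn := y.isLt
  rcases h with h | ⟨h, h' | ⟨rfl, h'⟩⟩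
  · refine aux _ _ _ _ ?_ hN
    have : (zeroCount F + 1) * (n + 1) ≤ zeroCount G * (n + 1) := Nat.mul_le_mul_right _ h
    have h2 : n - (x : ℕ) ≤ n := Nat.sub_le _ _
    have h3 : 0 < n - (y : ℕ) := by omega
    linarith
  · refine aux _ _ _ _ ?_ hN
    rw [h]
    have : (y : ℕ) < x := h'
    omega
  · rw [h]
    omega

lemma zeroCount_lt {F G : Fin n → ℕ} (h : ∀ x, F x = 0 → G x = 0) {y : Fin n} (hF : F y ≠ 0)
    (hG : G y = 0) : zeroCount F < zeroCount G := by
  refine Finset.card_lt_card ⟨fun x hx => ?_, fun hs => ?_⟩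
  · simp only [Finset.mem_filter, Finset.mem_univ, true_and] at hx ⊢
    exact h x hx
  · exact hF (by simpa using hs (by simpa using hG : y ∈ Finset.univ.filter fun x => G x = 0))

lemma zeroCount_congr {F G : Fin n → ℕ} (h : ∀ x, F x = 0 ↔ G x = 0) :
    zeroCount F = zeroCount G := by
  simp only [zeroCount, h]

/-- `G` arises from `F` by merging the consecutive blocks `j` and `j + 1`. -/
def IsMerge (j : ℕ) (F G : Fin n → ℕ) : Prop := ∀ y, G y = if F y ≤ j then F y else F y - 1

/-- `G` arises from `F` by merging block `m` into block `0`. -/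
def IsWrap (m : ℕ) (F G : Fin n → ℕ) : Prop :=
  ∀ y, (F y = m → G y = 0) ∧ (F y ≠ m → G y = F y)

lemma IsMatched.isMerge {F G : Fin n → ℕ} {x : Fin n}
    (hG : ∀ w, G w = if w = x then F x + 1 else if F w ≤ F x then F w else F w + 1) :
    IsMerge (F x) G F := by
  intro w
  have h := hG w
  by_cases hw : w = x
  · subst hw
    rw [h]
    simp
  · rw [if_neg hw] at h
    split_ifs at h ⊢ <;> omega

lemma IsMatched.zero_iff {F G : Fin n → ℕ} (h : IsMatched F G) (w : Fin n) :
    G w = 0 ↔ F w = 0 := by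
  obtain ⟨x, hx, -, hG⟩ := h
  have := hx.1.1
  have h := hG w
  split_ifs at h with hw
  · subst hw
    omega
  all_goals omega

lemma IsMatched.merge_unique {m j : ℕ} {F G : Fin n → ℕ} {x : Fin n}
    (hsurj : ∀ i < m, ∃ y, F y = i) (hlt : ∀ y, F y < m) (hpart : ∃ y, x < y ∧ F y = F x)
    (hG : ∀ w, G w = if w = x then F x + 1 else if F w ≤ F x then F w else F w + 1)
    (hj : IsMerge j G F) : j = F x := by
  rcases lt_trichotomy j (F x) with h | h | h
  · obtain ⟨y, hy, hyx⟩ : ∃ y, y ≠ x ∧ F y = j + 1 := by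
      by_cases h' : j + 1 = F x
      · obtain ⟨y, hy, hyx⟩ := hpart
        exact ⟨y, hy.ne', by omega⟩
      · obtain ⟨y, hy⟩ := hsurj (j + 1) (by have := hlt x; omega)
        exact ⟨y, by rintro rfl; exact h' hy.symm, hy⟩
    have h1 := hj y
    have h2 := hG y
    rw [if_neg hy] at h2
    split_ifs at h1 h2 <;> omega
  · exact h
  · have h1 := hj x
    rw [hG x, if_pos rfl] at h1
    split_ifs at h1 <;> omega

lemma IsMatched.zeroCount_lt_of_isWrap {m : ℕ} {F G F' : Fin n → ℕ} (h : IsMatched F G)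
    (hm : 0 < m) (hsurj : ∃ y, G y = m) (hw : IsWrap m G F') : zeroCount F < zeroCount F' := by
  rw [← zeroCount_congr h.zero_iff]
  obtain ⟨y, hy⟩ := hsurj
  refine zeroCount_lt (fun x hx => ?_) (y := y) (by omega) ((hw y).1 hy)
  rw [(hw x).2 (by omega), hx]

/-- Acyclicity of the matching. -/
lemma IsMatched.rank_lt_rank {m N : ℕ} {F G F' G' : Fin n → ℕ} (h : IsMatched F G)
    (h' : IsMatched F' G') (hne : F' ≠ F) (hm : 0 < m) (hN : ∀ x, F x < N)
    (hsurj : ∀ i < m + 1, ∃ y, G y = i)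
    (hface : (∃ j < m, IsMerge j G F') ∨ IsWrap m G F') : rank N F < rank N F' := by
  have hzero := h.zero_iff
  obtain ⟨x, hx, ⟨y, hxy, hy⟩, hG⟩ := id h
  obtain ⟨x', hx', ⟨y', hxy', hy'⟩, -⟩ := id h'
  rcases hface with ⟨j, hj, hF'⟩ | hw
  · rcases Nat.eq_zero_or_pos j with rfl | hj0
    · refine rank_lt hx hx' (hN x) (Or.inl ?_)
      rw [← zeroCount_congr hzero]
      obtain ⟨z, hz⟩ := hsurj 1 (by omega)
      refine zeroCount_lt (fun a ha => ?_) (y := z) (by omega) ?_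
      · rw [hF' a, ha]; simp
      · rw [hF' z, hz]; simp
    · have hz' : ∀ w, F' w = 0 ↔ G w = 0 := by
        intro w
        rw [hF' w]
        split_ifs <;> omega
      have hjx : j ≠ F x := by
        rintro rfl
        exact hne (funext fun w => (hF' w).trans (IsMatched.isMerge hG w).symm)
      refine rank_lt hx hx' (hN x) (Or.inr ⟨?_, ?_⟩)
      · rw [← zeroCount_congr hzero, zeroCount_congr hz']
      · have hx0 := hx.1.1
        have hGx : G x = F x + 1 := by rw [hG x, if_pos rfl]
        have hGy : G y = F x := by rw [hG y, if_neg hxy.ne', if_pos hy.le, hy]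
        have hF'x := hF' x
        have hF'y := hF' y
        rcases lt_trichotomy x x' with hlt | heq | hgt
        · exfalso
          refine hx'.2 x hlt ⟨?_, y, hxy, ?_, ?_⟩
          · rw [Ne, hz', hGx]; omega
          · rw [Ne, hz', hGy]; exact hx0
          · rw [hF'x, hF'y, hGx, hGy]
            split_ifs <;> omega
        · subst heq
          refine Or.inr ⟨rfl, ?_⟩
          rw [hGx] at hF'x
          by_cases hjp : F x + 1 ≤ j
          · rw [if_pos hjp] at hF'x; omega
          · exfalso
            rw [if_neg hjp] at hF'x
            have h1 := hF' y'
            have h2 := hG y'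
            rw [if_neg hxy'.ne'] at h2
            split_ifs at h1 h2 <;> omega
        · exact Or.inl hgt
  · exact rank_lt hx hx' (hN x) (Or.inl (h.zeroCount_lt_of_isWrap hm (hsurj m (by omega)) hw))

/-- A labelling whose pivot is alone in its block is an upper matched one. -/
lemma isMatched_of_isPivot {F G : Fin n → ℕ} {x : Fin n} (hx : IsPivot G x)
    (hsing : ∀ y, x < y → G y ≠ G x) (hsurj : ∃ y, G y = G x - 1)
    (hF : IsMerge (G x - 1) G F) : 2 ≤ G x ∧ IsMatched F G := by
  obtain ⟨⟨hx0, y, hxy, hy0, hy⟩, hmin⟩ := hx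
  have hyx := hsing y hxy
  have good : ∀ a < x, ∀ b, a < b → G a ≠ 0 → G b ≠ 0 → G a < G b := by
    intro a ha b hb ha0 hb0
    by_contra hcon
    exact hmin a ha ⟨ha0, b, hb, hb0, not_lt.mp hcon⟩
  have hsing' : ∀ w, w ≠ x → G w ≠ G x := by
    intro w hw
    rcases lt_or_gt_of_ne hw with h | h
    · by_cases hw0 : G w = 0
      · omega
      · exact (good w h x h hw0 hx0).ne
    · exact hsing w h
  have hFx : F x = G x - 1 := by
    rw [hF x]; split_ifs <;> omega
  have hz : ∀ w, F w = 0 ↔ G w = 0 := by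
    intro w
    rw [hF w]
    split_ifs <;> omega
  have below : ∀ a < x, G a ≠ 0 → G a < G x - 1 := by
    intro a ha ha0
    have := good a ha y (ha.trans hxy) ha0 hy0
    omega
  obtain ⟨z, hzx⟩ := hsurj
  have hxz : x < z := by
    rcases lt_trichotomy x z with h | h | h
    · exact h
    · subst h; omega
    · have := below z h (by omega)
      omega
  refine ⟨by omega, x, ⟨⟨by omega, y, hxy, by rwa [Ne, hz], ?_⟩, ?_⟩, ⟨z, hxz, ?_⟩, ?_⟩
  · rw [hF y, hFx]; split_ifs <;> omega
  · rintro a ha ⟨ha0, b, hab, hb0, hba⟩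
    rw [Ne, hz] at ha0 hb0
    have h1 := below a ha ha0
    have h2 := good a ha b hab ha0 hb0
    have h3 := hF a
    have h4 := hF b
    split_ifs at h3 h4 <;> omega
  · rw [hF z, hFx]; split_ifs <;> omega
  · intro w
    by_cases hw : w = x
    · subst hw; simp only [if_true]; omega
    · have := hsing' w hw
      rw [if_neg hw, hF w, hFx]
      split_ifs <;> omega

end Pivot

section Cells

variable {n k : ℕ}

/-- The labelling underlying a cell, with natural number labels. -/
def lab {P : (m : ℕ) → (Fin n → Fin m) → Prop} {m : ℕ} (f : CycBas n P m) (x : Fin n) : ℕ :=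
  (f.1 x : ℕ)

lemma lab_injective {P : (m : ℕ) → (Fin n → Fin m) → Prop} {m : ℕ} :
    Injective (lab : CycBas n P m → Fin n → ℕ) := fun _ _ h =>
  Subtype.ext (funext fun x => Fin.ext (congrFun h x))

lemma lab_lt {P : (m : ℕ) → (Fin n → Fin m) → Prop} {m : ℕ} (f : CycBas n P m) (x : Fin n) :
    lab f x < m := (f.1 x).isLt

lemma lab_surj {P : (m : ℕ) → (Fin n → Fin m) → Prop} {m : ℕ} (f : CycBas n P m) :
    ∀ i < m, ∃ x, lab f x = i := fun i hi => by
  obtain ⟨x, hx⟩ := f.2.1 ⟨i, hi⟩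
  exact ⟨x, by rw [lab, hx]⟩

lemma lab_zero {P : (m : ℕ) → (Fin n → Fin m) → Prop} {m : ℕ} (f : CycBas n P m) (x : Fin n)
    (hx : (x : ℕ) = 0) : lab f x = 0 := f.2.2.1 x hx

lemma starIn_of_card {m : ℕ} (hn : 0 < n) (f : Fin n → Fin m)
    (h0 : ∀ x : Fin n, (x : ℕ) = 0 → (f x : ℕ) = 0) (e : Finset (Fin n)) (he : e.card = k)
    (h0e : ∀ x : Fin n, (x : ℕ) = 0 → x ∈ e) (hz : ∀ x ∈ e, (f x : ℕ) = 0) :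
    starIn n k m f :=
  ⟨e, he, h0e, f ⟨0, hn⟩, fun x hx => Fin.ext (by rw [hz x hx, h0 _ rfl])⟩

/-- Labellings with more zero labels than a cell of the star complex are again cells. -/
lemma exists_cell (hn : 0 < n) {m m' : ℕ} (f : CycBas n (starIn n k) m) (F : Fin n → ℕ)
    (hlt : ∀ x, F x < m') (hsurj : ∀ i < m', ∃ x, F x = i) (hz : ∀ x, lab f x = 0 → F x = 0) :
    ∃ g : CycBas n (starIn n k) m', lab g = F := by
  obtain ⟨e, he, h0e, i, hi⟩ := f.2.2.2
  have h0 : ∀ x : Fin n, (x : ℕ) = 0 → F x = 0 := fun x hx => hz x (lab_zero f x hx)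
  refine ⟨⟨fun x => ⟨F x, hlt x⟩, fun i => ?_, h0, starIn_of_card hn _ h0 e he h0e ?_⟩, rfl⟩
  · obtain ⟨x, hx⟩ := hsurj i i.isLt
    exact ⟨x, Fin.ext hx⟩
  · intro x hx
    refine hz x ?_
    rw [lab, hi x hx, ← hi ⟨0, hn⟩ (h0e _ rfl)]
    exact lab_zero f _ rfl

lemma mergeMap_val {m : ℕ} (j : Fin m) (x : Fin (m + 1)) :
    (mergeMap j x : ℕ) = if (x : ℕ) ≤ j then (x : ℕ) else (x : ℕ) - 1 := by
  unfold mergeMap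
  split_ifs <;> rfl

lemma mergeMap_comp_eq_iff {P : (m : ℕ) → (Fin n → Fin m) → Prop} {m : ℕ} (j : Fin m)
    (f : CycBas n P (m + 1)) (g : CycBas n P m) :
    mergeMap j ∘ f.1 = g.1 ↔ IsMerge j (lab f) (lab g) := by
  rw [funext_iff]
  refine forall_congr' fun y => ?_
  rw [Fin.ext_iff, comp_apply, mergeMap_val, eq_comm]
  rfl

lemma cycMat_eq {P : (m : ℕ) → (Fin n → Fin m) → Prop} {m : ℕ} (f : CycBas n P (m + 1))
    (g : CycBas n P m) [∀ j, Decidable (IsMerge j (lab f) (lab g))]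
    [Decidable (IsWrap m (lab f) (lab g))] : cycMat n P m f g =
      (∑ j : Fin m, (-1 : ℚ) ^ (j : ℕ) * (if IsMerge j (lab f) (lab g) then 1 else 0))
        + (-1 : ℚ) ^ m * (if IsWrap m (lab f) (lab g) then 1 else 0) := by
  unfold cycMat
  congr 1
  · refine Finset.sum_congr rfl fun j _ => ?_
    congr 1
    exact if_congr (mergeMap_comp_eq_iff j f g) rfl rfl
  · congr 1
    exact if_congr Iff.rfl rfl rfl

lemma face_of_cycMat_ne_zero {P : (m : ℕ) → (Fin n → Fin m) → Prop} {m : ℕ}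
    {f : CycBas n P (m + 1)} {g : CycBas n P m} (h : cycMat n P m f g ≠ 0) :
    (∃ j < m, IsMerge j (lab f) (lab g)) ∨ IsWrap m (lab f) (lab g) := by
  classical
  by_contra! hcon
  refine h ?_
  rw [cycMat_eq, if_neg hcon.2, Finset.sum_eq_zero]
  · simp
  · intro j _
    rw [if_neg (hcon.1 j j.isLt), mul_zero]

lemma cycMat_ne_zero_of_isMatched {P : (m : ℕ) → (Fin n → Fin m) → Prop} {m : ℕ}
    {f : CycBas n P m} {h : CycBas n P (m + 1)} (hm : IsMatched (lab f) (lab h)) :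
    cycMat n P m h f ≠ 0 := by
  classical
  obtain ⟨x, hx, hpart, hG⟩ := id hm
  have hxm := lab_lt f x
  have hw : ¬ IsWrap m (lab h) (lab f) := fun hw =>
    lt_irrefl _ (hm.zeroCount_lt_of_isWrap (by omega) (lab_surj h m (by omega)) hw)
  rw [cycMat_eq, if_neg hw, Finset.sum_eq_single ⟨lab f x, hxm⟩]
  · rw [if_pos (IsMatched.isMerge hG)]
    simp
  · intro j _ hj
    rw [if_neg, mul_zero]
    intro hmerge
    exact hj (Fin.ext (IsMatched.merge_unique (F := lab f) (lab_surj f) (lab_lt f) hpart hG hmerge))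
  · simp

lemma rank_lt_rank_of_cycMat {P : (m : ℕ) → (Fin n → Fin m) → Prop} {m : ℕ}
    (f : CycBas n P m) (h : CycBas n P (m + 1)) (f' : CycBas n P m) (h' : CycBas n P (m + 1))
    (hm : IsMatched (lab f) (lab h)) (hm' : IsMatched (lab f') (lab h')) (hne : f' ≠ f)
    (hM : cycMat n P m h f' ≠ 0) : rank m (lab f) < rank m (lab f') := by
  obtain ⟨x, -⟩ := id hm
  exact hm.rank_lt_rank hm' (fun e => hne (lab_injective e)) (by have := lab_lt f x; omega)
    (lab_lt f) (lab_surj h) (face_of_cycMat_ne_zero hM)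

/-- A cell is critical if its labels increase along the vertices with nonzero label. -/
def IsCritical {P : (m : ℕ) → (Fin n → Fin m) → Prop} {m : ℕ} (g : CycBas n P m) : Prop :=
  ∀ x, ¬ IsBad (lab g) x

lemma IsCritical.lt_iff {P : (m : ℕ) → (Fin n → Fin m) → Prop} {m : ℕ} {g : CycBas n P m}
    (hg : IsCritical g) {x y : Fin n} (hx : lab g x ≠ 0) (hy : lab g y ≠ 0) :
    x < y ↔ lab g x < lab g y := by
  have key : ∀ {x y : Fin n}, lab g x ≠ 0 → lab g y ≠ 0 → x < y → lab g x < lab g y := by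
    intro x y hx hy hxy
    by_contra hcon
    exact hg x ⟨hx, y, hxy, hy, not_lt.mp hcon⟩
  refine ⟨key hx hy, fun h => ?_⟩
  rcases lt_trichotomy x y with h' | rfl | h'
  · exact h'
  · omega
  · have := key hy hx h'
    omega

lemma IsCritical.injOn {P : (m : ℕ) → (Fin n → Fin m) → Prop} {m : ℕ} {g : CycBas n P m}
    (hg : IsCritical g) {x y : Fin n} (hx : lab g x ≠ 0) (h : lab g x = lab g y) : x = y := by
  rcases lt_trichotomy x y with h' | h' | h'
  · have := (hg.lt_iff hx (h ▸ hx)).mp h'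
    omega
  · exact h'
  · have := (hg.lt_iff (h ▸ hx) hx).mp h'
    omega

/-- Every noncritical cell of the star complex is matched. -/
lemma isMatched_or_isMatched_of_not_isCritical {m : ℕ} (g : CycBas n (starIn n k) (m + 1))
    (hg : ¬ IsCritical g) :
    (∃ f : CycBas n (starIn n k) m, IsMatched (lab f) (lab g)) ∨
      ∃ h : CycBas n (starIn n k) (m + 2), IsMatched (lab g) (lab h) := by
  unfold IsCritical at hg
  push Not at hg
  obtain ⟨x, hx⟩ := exists_isPivot hg
  have hn : 0 < n := x.pos
  have hx0 := hx.1.1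
  by_cases hpart : ∃ y, x < y ∧ lab g y = lab g x
  · right
    suffices hex : ∃ h : CycBas n (starIn n k) (m + 2), lab h = fun w =>
        if w = x then lab g x + 1 else if lab g w ≤ lab g x then lab g w else lab g w + 1 by
      obtain ⟨h, hh⟩ := hex
      exact ⟨h, x, hx, hpart, fun w => congrFun hh w⟩
    refine exists_cell hn g _ ?_ ?_ ?_
    · intro w
      have := lab_lt g w
      have := lab_lt g x
      split_ifs <;> omega
    · intro i hi
      have hxm := lab_lt g x
      obtain ⟨y, hxy, hy⟩ := hpart
      rcases lt_trichotomy i (lab g x + 1) with h | h | h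
      · by_cases h' : i = lab g x
        · exact ⟨y, by simp only [hxy.ne', if_false, hy, le_refl, if_true, h']⟩
        · obtain ⟨z, hz⟩ := lab_surj g i (by omega)
          refine ⟨z, ?_⟩
          have : z ≠ x := by rintro rfl; exact h' hz.symm
          simp only [this, if_false, hz]
          split_ifs <;> omega
      · exact ⟨x, by simp [h]⟩
      · obtain ⟨z, hz⟩ := lab_surj g (i - 1) (by omega)
        refine ⟨z, ?_⟩
        have : z ≠ x := by rintro rfl; omega
        simp only [this, if_false, hz]
        split_ifs <;> omega
    · intro w hw
      have : w ≠ x := by rintro rfl; exact hx0 hw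
      simp [this, hw]
  · left
    push Not at hpart
    have hxm := lab_lt g x
    have key := fun F => isMatched_of_isPivot (F := F) hx hpart (lab_surj g _ (by omega))
    have h2 := (key _ fun _ => rfl).1
    suffices hex : ∃ f : CycBas n (starIn n k) m, lab f = fun w =>
        if lab g w ≤ lab g x - 1 then lab g w else lab g w - 1 by
      obtain ⟨f, hf⟩ := hex
      exact ⟨f, (key _ fun w => congrFun hf w).2⟩
    refine exists_cell hn g _ ?_ ?_ ?_
    · intro w
      have := lab_lt g w
      split_ifs <;> omega
    · intro i hi
      by_cases hi' : i ≤ lab g x - 1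
      · obtain ⟨z, hz⟩ := lab_surj g i (by omega)
        exact ⟨z, by simp [hz, hi']⟩
      · obtain ⟨z, hz⟩ := lab_surj g (i + 1) (by omega)
        refine ⟨z, ?_⟩
        simp only [hz]
        split_ifs <;> omega
    · intro w hw
      simp [hw]

end Cells

section Antisymmetric

variable {n k : ℕ}

/-- The permutation of the labels `0, …, q` acting as `π` on the nonzero ones. -/
def labelPerm {q : ℕ} (π : Equiv.Perm (Fin q)) : Fin (q + 1) → Fin (q + 1) :=
  Fin.cases 0 fun i => (π i).succ

@[simp] lemma labelPerm_zero {q : ℕ} (π : Equiv.Perm (Fin q)) : labelPerm π 0 = 0 := rfl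

@[simp] lemma labelPerm_succ {q : ℕ} (π : Equiv.Perm (Fin q)) (i : Fin q) :
    labelPerm π i.succ = (π i).succ := rfl

lemma labelPerm_mul {q : ℕ} (π ρ : Equiv.Perm (Fin q)) (i : Fin (q + 1)) :
    labelPerm (π * ρ) i = labelPerm π (labelPerm ρ i) := by
  refine Fin.cases ?_ (fun i => ?_) i <;> simp

lemma labelPerm_one {q : ℕ} (i : Fin (q + 1)) : labelPerm (1 : Equiv.Perm (Fin q)) i = i := by
  refine Fin.cases ?_ (fun i => ?_) i <;> simp

/-- Permuting the blocks of a cell other than the first one. -/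
def permCell {q : ℕ} (π : Equiv.Perm (Fin q)) (f : CycBas n (starIn n k) (q + 1)) :
    CycBas n (starIn n k) (q + 1) :=
  ⟨labelPerm π ∘ f.1, by
    have hs : Surjective (labelPerm π) := fun i =>
      ⟨labelPerm π⁻¹ i, by rw [← labelPerm_mul, mul_inv_cancel, labelPerm_one]⟩
    refine ⟨hs.comp f.2.1, fun x hx => ?_, ?_⟩
    · have : f.1 x = 0 := Fin.ext (f.2.2.1 x hx)
      simp [this]
    · obtain ⟨e, he, h0, i, hi⟩ := f.2.2.2
      exact ⟨e, he, h0, labelPerm π i, fun x hx => congrArg _ (hi x hx)⟩⟩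

lemma permCell_apply {q : ℕ} (π : Equiv.Perm (Fin q)) (f : CycBas n (starIn n k) (q + 1))
    (x : Fin n) : (permCell π f).1 x = labelPerm π (f.1 x) := rfl

/-- `permCell` as a bijection. -/
def permCellEquiv {q : ℕ} (π : Equiv.Perm (Fin q)) :
    CycBas n (starIn n k) (q + 1) ≃ CycBas n (starIn n k) (q + 1) where
  toFun := permCell π
  invFun := permCell π⁻¹
  left_inv f := Subtype.ext (funext fun x => by
    rw [permCell_apply, permCell_apply, ← labelPerm_mul, inv_mul_cancel, labelPerm_one])
  right_inv f := Subtype.ext (funext fun x => by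
    rw [permCell_apply, permCell_apply, ← labelPerm_mul, mul_inv_cancel, labelPerm_one])

lemma permCellEquiv_apply {q : ℕ} (π : Equiv.Perm (Fin q))
    (f : CycBas n (starIn n k) (q + 1)) : permCellEquiv π f = permCell π f := rfl

lemma zChain_permCell {q : ℕ} (A : Finset (Fin n)) (av : Fin q → Fin n)
    (π : Equiv.Perm (Fin q)) (f : CycBas n (starIn n k) (q + 1)) :
    zChain n k q A av (permCell π f) = ((Equiv.Perm.sign π : ℤ) : ℚ) * zChain n k q A av f := by
  unfold zChain
  rw [← Equiv.sum_comp (Equiv.mulRight π⁻¹), Finset.mul_sum]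
  refine Finset.sum_congr rfl fun σ _ => ?_
  have h0 : ∀ i, ((labelPerm π i : Fin (q + 1)) : ℕ) = 0 ↔ (i : ℕ) = 0 := by
    intro i
    refine Fin.cases ?_ (fun i => ?_) i <;> simp
  have h1 : ∀ (i) (t : Fin q), ((labelPerm π i : Fin (q + 1)) : ℕ) = (π t : ℕ) + 1 ↔
      (i : ℕ) = t + 1 := by
    intro i t
    refine Fin.cases ?_ (fun i => ?_) i
    · simp
    · simp [← Fin.ext_iff]
  have h2 : (∀ t : Fin q, ((permCell π f).1 (av ((Equiv.mulRight π⁻¹ σ) t)) : ℕ) = (t : ℕ) + 1) ↔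
      ∀ t : Fin q, (f.1 (av (σ t)) : ℕ) = (t : ℕ) + 1 := by
    rw [← π.forall_congr_right]
    refine forall_congr' fun t => ?_
    rw [permCell_apply, h1]
    simp
  have h3 : (∀ x : Fin n, (x ∈ A ∨ (x : ℕ) = 0) → ((permCell π f).1 x : ℕ) = 0) ↔
      ∀ x : Fin n, (x ∈ A ∨ (x : ℕ) = 0) → (f.1 x : ℕ) = 0 := by
    simp only [permCell_apply, h0]
  rw [if_congr (and_congr h3 h2) rfl rfl, mul_ite, mul_zero]
  refine if_congr Iff.rfl ?_ rfl
  simp [mul_comm]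

lemma mergeMap_labelPerm_swap {m : ℕ} (i : Fin m) (l : Fin (m + 2)) :
    mergeMap i.succ (labelPerm (Equiv.swap i.castSucc i.succ) l) = mergeMap i.succ l := by
  refine Fin.cases rfl (fun l => ?_) l
  rw [labelPerm_succ]
  by_cases h1 : l = i.castSucc
  · subst h1
    rw [Equiv.swap_apply_left]
    ext
    simp [mergeMap_val]
  · by_cases h2 : l = i.succ
    · subst h2
      rw [Equiv.swap_apply_right]
      ext
      simp [mergeMap_val]
    · rw [Equiv.swap_apply_of_ne_of_ne h1 h2]

lemma labelPerm_finRotate_inv_val {m : ℕ} (l : Fin (m + 2)) :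
    (labelPerm (finRotate (m + 1))⁻¹ l : ℕ) =
      if (l : ℕ) = 0 then 0 else if (l : ℕ) = 1 then m + 1 else (l : ℕ) - 1 := by
  refine Fin.cases ?_ (fun l => ?_) l
  · simp
  · rw [labelPerm_succ]
    refine Fin.cases ?_ (fun l => ?_) l
    · have : (finRotate (m + 1))⁻¹ 0 = Fin.last m := by
        rw [Equiv.Perm.inv_eq_iff_eq, finRotate_last]
      simp [this]
    · have : (finRotate (m + 1))⁻¹ l.succ = l.castSucc := by
        rw [Equiv.Perm.inv_eq_iff_eq]
        ext
        rw [coe_finRotate_of_ne_last]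
        · simp
        · exact (Fin.castSucc_lt_last l).ne
      simp [this]

/-- Chains which are antisymmetric in the blocks other than the first one are cycles. -/
lemma cycBnd_eq_zero_of_antisymmetric (hn : 0 < n) {q : ℕ}
    (c : CycBas n (starIn n k) (q + 1) → ℚ)
    (hc : ∀ π f, c (permCell π f) = ((Equiv.Perm.sign π : ℤ) : ℚ) * c f) :
    cycBnd n (starIn n k) q c = 0 := by
  classical
  funext g
  cases q with
  | zero => exact (g.1 ⟨0, hn⟩).elim0
  | succ m =>
    have hS : ∀ i : Fin m, ∑ f, c f * (if mergeMap i.succ ∘ f.1 = g.1 then 1 else 0) = 0 := by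
      intro i
      set π := Equiv.swap i.castSucc i.succ
      have hsign : Equiv.Perm.sign π = -1 := Equiv.Perm.sign_swap (Fin.castSucc_lt_succ).ne
      have h := Equiv.sum_comp (permCellEquiv π)
        (fun f => c f * (if mergeMap i.succ ∘ f.1 = g.1 then 1 else 0))
      have h' : ∀ f : CycBas n (starIn n k) (m + 2),
          mergeMap i.succ ∘ (permCell π f).1 = mergeMap i.succ ∘ f.1 :=
        fun f => funext fun x => mergeMap_labelPerm_swap i (f.1 x)
      simp only [permCellEquiv_apply, hc, h', hsign] at h
      simp only [Units.val_neg, Units.val_one, Int.cast_neg, Int.cast_one, neg_mul, one_mul,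
        Finset.sum_neg_distrib] at h
      linarith
    have hW : ∑ f, c f * (if IsWrap (m + 1) (lab f) (lab g) then 1 else 0) =
        (-1) ^ m * ∑ f, c f * (if mergeMap 0 ∘ f.1 = g.1 then 1 else 0) := by
      rw [← Equiv.sum_comp (permCellEquiv (finRotate (m + 1))⁻¹), Finset.mul_sum]
      refine Finset.sum_congr rfl fun f _ => ?_
      simp only [permCellEquiv_apply, hc, Equiv.Perm.sign_inv, sign_finRotate]
      rw [mul_assoc]
      congr 1
      · simp
      · congr 1
        refine if_congr ?_ rfl rfl
        rw [mergeMap_comp_eq_iff]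
        refine forall_congr' fun y => ?_
        have h1 : lab (permCell (finRotate (m + 1))⁻¹ f) y = _ :=
          labelPerm_finRotate_inv_val (f.1 y)
        have h2 := lab_lt f y
        change _ = if lab f y = 0 then 0 else if lab f y = 1 then m + 1 else lab f y - 1 at h1
        rw [h1, Fin.val_zero]
        split_ifs <;> omega
    change matLin (cycMat n (starIn n k) (m + 1)) c g = 0
    rw [matLin_apply]
    have : ∀ f : CycBas n (starIn n k) (m + 2), c f * cycMat n (starIn n k) (m + 1) f g =
        (∑ j : Fin (m + 1), (-1) ^ (j : ℕ) * (c f * (if mergeMap j ∘ f.1 = g.1 then 1 else 0))) +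
          (-1) ^ (m + 1) * (c f * (if IsWrap (m + 1) (lab f) (lab g) then 1 else 0)) := by
      intro f
      rw [cycMat_eq]
      simp only [mergeMap_comp_eq_iff, mul_add, Finset.mul_sum]
      congr 1
      · exact Finset.sum_congr rfl fun j _ => by ring
      · ring
    rw [Finset.sum_congr rfl fun f _ => this f, Finset.sum_add_distrib, Finset.sum_comm]
    simp only [← Finset.mul_sum]
    rw [Fin.sum_univ_succ, hW]
    simp only [hS, mul_zero, Finset.sum_const_zero, add_zero]
    have : ((-1 : ℚ) ^ m) * (-1) ^ m = 1 := by rw [← mul_pow]; simp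
    rw [pow_succ]
    simp only [Fin.val_zero, pow_zero]
    linear_combination (-∑ f, c f * (if mergeMap 0 ∘ f.1 = g.1 then 1 else 0)) * this

end Antisymmetric

section Square

variable {n k : ℕ}

/-- The effect of the `i`-th face map on the labels `0, …, m`. -/
def faceLab (m i l : ℕ) : ℕ :=
  if i < m then (if l ≤ i then l else l - 1) else if l = m then 0 else l

lemma faceLab_comm {m i j l : ℕ} (hij : i < j) (hj : j < m + 2) (hl : l < m + 2) :
    faceLab m i (faceLab (m + 1) j l) = faceLab m (j - 1) (faceLab (m + 1) i l) := by
  unfold faceLab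
  split_ifs <;> omega

lemma faceLab_lt {m i l : ℕ} (hi : i < m + 2) (hl : l < m + 2) : faceLab (m + 1) i l < m + 1 := by
  unfold faceLab
  split_ifs <;> omega

lemma exists_faceLab_eq {m i a : ℕ} (ha : a < m + 1) :
    ∃ l < m + 2, faceLab (m + 1) i l = a := by
  by_cases h : i < m + 1 ∧ i < a
  · refine ⟨a + 1, by omega, ?_⟩
    unfold faceLab
    split_ifs <;> omega
  · refine ⟨a, by omega, ?_⟩
    unfold faceLab
    split_ifs <;> omega

lemma cycBnd_apply {P : (m : ℕ) → (Fin n → Fin m) → Prop} {m : ℕ} (c : CycBas n P (m + 1) → ℚ)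
    (g : CycBas n P m) : cycBnd n P m c g = ∑ i ∈ Finset.range (m + 1),
      (-1 : ℚ) ^ i * ∑ f, c f * (if lab g = faceLab m i ∘ lab f then 1 else 0) := by
  classical
  have hmat : ∀ f, cycMat n P m f g = ∑ i ∈ Finset.range (m + 1),
      (-1 : ℚ) ^ i * (if lab g = faceLab m i ∘ lab f then 1 else 0) := by
    intro f
    rw [cycMat_eq, Finset.sum_range_succ, Finset.sum_range]
    congr 1
    · refine Finset.sum_congr rfl fun j _ => ?_
      congr 1
      refine if_congr ?_ rfl rfl
      rw [funext_iff]
      refine forall_congr' fun y => ?_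
      rw [comp_apply, faceLab, if_pos j.isLt]
    · congr 1
      refine if_congr ?_ rfl rfl
      rw [funext_iff]
      refine forall_congr' fun y => ?_
      rw [comp_apply, faceLab, if_neg (lt_irrefl m)]
      split_ifs <;> tauto
  change matLin (cycMat n P m) c g = _
  simp only [matLin_apply, hmat, Finset.mul_sum]
  rw [Finset.sum_comm]
  exact Finset.sum_congr rfl fun i _ => Finset.sum_congr rfl fun f _ => by ring

lemma exists_face (hn : 0 < n) {m i : ℕ} (hi : i < m + 2) (f : CycBas n (starIn n k) (m + 2)) :
    ∃ g : CycBas n (starIn n k) (m + 1), lab g = faceLab (m + 1) i ∘ lab f := by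
  refine exists_cell hn f _ (fun x => faceLab_lt hi (lab_lt f x)) (fun a ha => ?_) ?_
  · obtain ⟨l, hl, hla⟩ := exists_faceLab_eq (i := i) ha
    obtain ⟨x, hx⟩ := lab_surj f l hl
    exact ⟨x, by rw [comp_apply, hx, hla]⟩
  · intro x hx
    rw [comp_apply, hx]
    unfold faceLab
    split_ifs <;> omega

/-- The alternating double sum of a family satisfying the presimplicial identities is zero. -/
lemma sum_alternating_eq_zero (m : ℕ) (a : ℕ → ℕ → ℚ)
    (ha : ∀ i j, i < j → j < m + 2 → a i j = a (j - 1) i) :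
    ∑ i ∈ Finset.range (m + 1), ∑ j ∈ Finset.range (m + 2), (-1 : ℚ) ^ (i + j) * a i j = 0 := by
  rw [← Finset.sum_product']
  refine Finset.sum_involution
    (fun p _ => if p.1 < p.2 then (p.2 - 1, p.1) else (p.2, p.1 + 1)) ?_ ?_ ?_ ?_
  · rintro ⟨i, j⟩ h
    simp only [Finset.mem_product, Finset.mem_range] at h
    by_cases hij : i < j
    · obtain ⟨j, rfl⟩ : ∃ j', j = j' + 1 := ⟨j - 1, by omega⟩
      simp only [hij, if_true, ha i (j + 1) hij h.2, Nat.add_sub_cancel]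
      ring
    · simp only [hij, if_false, ha j (i + 1) (by omega) (by omega), Nat.add_sub_cancel]
      ring
  · rintro ⟨i, j⟩ h - heq
    dsimp only at heq
    split_ifs at heq <;> simp only [Prod.mk.injEq] at heq <;> omega
  · rintro ⟨i, j⟩ h
    simp only [Finset.mem_product, Finset.mem_range] at h ⊢
    split_ifs <;> dsimp only <;> omega
  · rintro ⟨i, j⟩ h
    dsimp only
    by_cases hij : i < j
    · have h2 : ¬ j - 1 < i := by omega
      simp only [hij, if_true, h2, if_false, Prod.mk.injEq, true_and]
      omega
    · have h2 : j < i + 1 := by omega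
      simp only [hij, if_false, h2, if_true, Prod.mk.injEq, and_true]
      omega

lemma cycBnd_cycBnd (hn : 0 < n) (q : ℕ) (w : CycBas n (starIn n k) (q + 2) → ℚ) :
    cycBnd n (starIn n k) q (cycBnd n (starIn n k) (q + 1) w) = 0 := by
  classical
  funext h
  set a : ℕ → ℕ → ℚ := fun i j =>
    ∑ f, w f * (if lab h = faceLab q i ∘ faceLab (q + 1) j ∘ lab f then 1 else 0) with ha
  refine Eq.trans ?_ (sum_alternating_eq_zero q a fun i j hij hj => ?_)
  · rw [cycBnd_apply]
    refine Finset.sum_congr rfl fun i _ => ?_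
    simp only [cycBnd_apply, Finset.sum_mul]
    rw [Finset.sum_comm, Finset.mul_sum]
    refine Finset.sum_congr rfl fun j hj => ?_
    simp only [mul_assoc, ← Finset.mul_sum]
    rw [pow_add, mul_assoc, ha]
    congr 2
    simp only [Finset.sum_mul]
    rw [Finset.sum_comm]
    refine Finset.sum_congr rfl fun f _ => ?_
    obtain ⟨g, hg⟩ := exists_face hn (Finset.mem_range.mp hj) f
    rw [Finset.sum_eq_single g]
    · rw [← hg, if_pos rfl, mul_one]
    · intro g' _ hne
      rw [if_neg fun e => hne (lab_injective (e.trans hg.symm))]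
      simp
    · simp
  · simp only [ha]
    refine Finset.sum_congr rfl fun f _ => ?_
    congr 1
    refine if_congr ?_ rfl rfl
    have : faceLab q i ∘ faceLab (q + 1) j ∘ lab f =
        faceLab q (j - 1) ∘ faceLab (q + 1) i ∘ lab f :=
      funext fun x => faceLab_comm hij hj (lab_lt f x)
    rw [this]

end Square

section Critical

variable {n k q : ℕ}

/-- The vertices other than the first one that lie in the first block of `g`. -/
def zeroSet {P : (m : ℕ) → (Fin n → Fin m) → Prop} {m : ℕ} (g : CycBas n P m) :
    Finset (Fin n) :=
  Finset.univ.filter fun x => lab g x = 0 ∧ (x : ℕ) ≠ 0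

lemma mem_zeroSet {P : (m : ℕ) → (Fin n → Fin m) → Prop} {m : ℕ} {g : CycBas n P m}
    {x : Fin n} : x ∈ zeroSet g ↔ lab g x = 0 ∧ (x : ℕ) ≠ 0 := by
  simp [zeroSet]

lemma mem_zeroSet_or {P : (m : ℕ) → (Fin n → Fin m) → Prop} {m : ℕ} {g : CycBas n P m}
    {x : Fin n} : x ∈ zeroSet g ∨ (x : ℕ) = 0 ↔ lab g x = 0 := by
  have := lab_zero g x
  rw [mem_zeroSet]
  tauto

lemma IsCritical.strictMono {g : CycBas n (starIn n k) (q + 1)} (hg : IsCritical g)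
    {av : Fin q → Fin n} (hav : ∀ t, lab g (av t) = t + 1) : StrictMono av := by
  intro s t hst
  rw [hg.lt_iff (by rw [hav]; omega) (by rw [hav]; omega), hav, hav]
  exact Nat.succ_lt_succ hst

lemma IsCritical.mem_range_iff {g : CycBas n (starIn n k) (q + 1)} (hg : IsCritical g)
    {av : Fin q → Fin n} (hav : ∀ t, lab g (av t) = t + 1) (x : Fin n) :
    x ∈ Set.range av ↔ lab g x ≠ 0 := by
  constructor
  · rintro ⟨t, rfl⟩
    rw [hav]
    omega
  · intro hx
    have hlt := lab_lt g x
    refine ⟨⟨lab g x - 1, by omega⟩, ?_⟩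
    refine (hg.injOn hx ?_).symm
    rw [hav]
    simp only
    omega

/-- The chain `z_A` of a critical cell takes the value one at this cell and zero at all other
critical cells. -/
lemma zChain_of_isCritical {g g' : CycBas n (starIn n k) (q + 1)} (hg : IsCritical g)
    {av : Fin q → Fin n} (hav : ∀ t, lab g (av t) = t + 1) (hg' : IsCritical g') :
    zChain n k q (zeroSet g) av g' = if g' = g then 1 else 0 := by
  have hmono := hg.strictMono hav
  have key : ∀ σ : Equiv.Perm (Fin q),
      ((∀ x : Fin n, (x ∈ zeroSet g ∨ (x : ℕ) = 0) → (g'.1 x : ℕ) = 0) ∧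
        (∀ t : Fin q, (g'.1 (av (σ t)) : ℕ) = (t : ℕ) + 1)) ↔ g' = g ∧ σ = 1 := by
    intro σ
    constructor
    · rintro ⟨h0, h1⟩
      have hσ : σ = 1 := by
        have hm : StrictMono σ := fun s t hst =>
          hmono.lt_iff_lt.mp (hg'.strictMono (av := av ∘ σ) h1 hst)
        refine Equiv.ext fun t => congrFun ((hm.range_inj strictMono_id).mp ?_) t
        rw [σ.surjective.range_eq, Set.range_id]
      subst hσ
      refine ⟨lab_injective (funext fun x => ?_), rfl⟩
      by_cases hx : lab g x = 0
      · rw [hx]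
        exact h0 x (mem_zeroSet_or.mpr hx)
      · obtain ⟨t, rfl⟩ := (hg.mem_range_iff hav x).mpr hx
        rw [hav]
        exact h1 t
    · rintro ⟨rfl, rfl⟩
      exact ⟨fun x hx => mem_zeroSet_or.mp hx, hav⟩
  unfold zChain
  simp only [key]
  by_cases h : g' = g
  · simp [h]
  · simp [h]

/-- The chain `z_A` of a critical cell vanishes on all lower matched cells. -/
lemma zChain_of_isMatched {g f : CycBas n (starIn n k) (q + 1)} (hg : IsCritical g)
    {av : Fin q → Fin n} (hav : ∀ t, lab g (av t) = t + 1) {G : Fin n → ℕ}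
    (hf : IsMatched (lab f) G) : zChain n k q (zeroSet g) av f = 0 := by
  refine Finset.sum_eq_zero fun σ _ => if_neg ?_
  rintro ⟨h0, h1⟩
  obtain ⟨x, y, hxy, hx, he⟩ := hf.not_injOn
  have hr : ∀ x, lab f x ≠ 0 → ∃ t, x = av (σ t) := by
    intro x hx
    have hgx : lab g x ≠ 0 := fun h => hx (h0 x (mem_zeroSet_or.mpr h))
    obtain ⟨t, rfl⟩ := (hg.mem_range_iff hav x).mpr hgx
    exact ⟨σ⁻¹ t, by simp⟩
  obtain ⟨s, rfl⟩ := hr x hx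
  obtain ⟨t, rfl⟩ := hr y (he ▸ hx)
  have hs : lab f (av (σ s)) = s + 1 := h1 s
  have ht : lab f (av (σ t)) = t + 1 := h1 t
  exact hxy (by rw [Fin.ext (by omega : (s : ℕ) = t)])

/-- A cell with increasing labels `1, …, q` has an enumeration of its singleton blocks. -/
lemma exists_enumeration (g : CycBas n (starIn n k) (q + 1)) :
    ∃ av : Fin q → Fin n, ∀ t, lab g (av t) = t + 1 := by
  have h : ∀ t : Fin q, ∃ x, lab g x = t + 1 := fun t => lab_surj g _ (by omega)
  choose av hav using h
  exact ⟨av, hav⟩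

lemma IsCritical.card_zeroSet {g : CycBas n (starIn n k) (q + 1)} (hn : 0 < n)
    (hg : IsCritical g) : (zeroSet g).card = n - q - 1 := by
  classical
  obtain ⟨av, hav⟩ := exists_enumeration g
  have hun : (insert ⟨0, hn⟩ (zeroSet g))ᶜ = Finset.univ.image av := by
    ext x
    have h1 : x = ⟨0, hn⟩ ↔ (x : ℕ) = 0 := Fin.ext_iff
    have h2 := hg.mem_range_iff hav x
    rw [Finset.mem_compl, Finset.mem_insert, h1, or_comm, mem_zeroSet_or]
    simpa using h2.symm
  have hc := congrArg Finset.card hun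
  rw [Finset.card_compl, Finset.card_insert_of_notMem (by simp [mem_zeroSet]),
    Finset.card_image_of_injective _ (hg.strictMono hav).injective, Finset.card_fin,
    Fintype.card_fin] at hc
  have := Finset.card_le_univ (insert ⟨0, hn⟩ (zeroSet g))
  rw [Finset.card_insert_of_notMem (by simp [mem_zeroSet]), Fintype.card_fin] at this
  omega

/-- Every admissible set `A` with an increasing enumeration of its complement comes from a
critical cell. -/
lemma exists_isCritical (hn : 0 < n) (hk : 0 < k) (hkn : k ≤ n) (hq : q ≤ n - k)
    (A : Finset (Fin n)) (hA : ∀ x ∈ A, (x : ℕ) ≠ 0) (hcard : A.card = n - q - 1)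
    (av : Fin q → Fin n) (hmono : StrictMono av)
    (hrange : ∀ x : Fin n, (x ∉ A ∧ (x : ℕ) ≠ 0) ↔ x ∈ Set.range av) :
    ∃ g : CycBas n (starIn n k) (q + 1), IsCritical g ∧ zeroSet g = A ∧
      ∀ t, lab g (av t) = t + 1 := by
  classical
  let F : Fin n → Fin (q + 1) := fun x => if h : ∃ t, av t = x then h.choose.succ else 0
  have hF : ∀ t, F (av t) = t.succ := by
    intro t
    have h : ∃ s, av s = av t := ⟨t, rfl⟩
    simp only [F, dif_pos h]
    rw [hmono.injective h.choose_spec]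
  have hF0 : ∀ x, F x = 0 ↔ x ∉ Set.range av := by
    intro x
    by_cases h : ∃ t, av t = x
    · obtain ⟨t, rfl⟩ := h
      simp [hF]
    · simp only [F, dif_neg h, true_iff]
      exact h
  have hzero : ∀ x, F x = 0 ↔ x ∈ A ∨ (x : ℕ) = 0 := by
    intro x
    rw [hF0, ← hrange]
    tauto
  have hz : ∀ x : Fin n, (x : ℕ) = 0 → (F x : ℕ) = 0 := fun x hx => by
    rw [(hzero x).mpr (Or.inr hx)]; rfl
  have hstar : starIn n k (q + 1) F := by
    have h0A : (⟨0, hn⟩ : Fin n) ∉ A := fun h => hA _ h rfl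
    obtain ⟨e, he, heA⟩ := Finset.exists_subset_card_eq (s := A) (n := k - 1) (by omega)
    refine starIn_of_card hn F hz (insert ⟨0, hn⟩ e) ?_ ?_ ?_
    · rw [Finset.card_insert_of_notMem fun h => h0A (he h), heA]
      omega
    · intro x hx
      exact Finset.mem_insert.mpr (Or.inl (Fin.ext hx))
    · intro x hx
      rcases Finset.mem_insert.mp hx with rfl | hx
      · exact hz _ rfl
      · rw [(hzero x).mpr (Or.inl (he hx))]; rfl
  refine ⟨⟨F, ?_, hz, hstar⟩, ?_, ?_, fun t => ?_⟩
  · refine Fin.cases ⟨⟨0, hn⟩, Fin.ext (hz _ rfl)⟩ fun t => ⟨av t, hF t⟩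
  · rintro x ⟨hx, y, hxy, hy, hle⟩
    have hr : ∀ x, (F x : ℕ) ≠ 0 → x ∈ Set.range av := by
      intro x hx
      by_contra h
      exact hx (by rw [(hF0 x).mpr h]; rfl)
    obtain ⟨s, rfl⟩ := hr x hx
    obtain ⟨t, rfl⟩ := hr y hy
    have hst := hmono.lt_iff_lt.mp hxy
    change (F (av t) : ℕ) ≤ F (av s) at hle
    rw [hF, hF, Fin.val_succ, Fin.val_succ] at hle
    have : (s : ℕ) < t := hst
    omega
  · ext x
    have h1 : ((F x : ℕ) = 0) ↔ F x = 0 := by rw [Fin.ext_iff]; rfl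
    refine mem_zeroSet.trans ?_
    change (F x : ℕ) = 0 ∧ _ ↔ _
    rw [h1, hzero]
    have := hA x
    tauto
  · change (F (av t) : ℕ) = _
    rw [hF, Fin.val_succ]

lemma cycBnd_zChain (hn : 0 < n) (A : Finset (Fin n)) (av : Fin q → Fin n) :
    cycBnd n (starIn n k) q (zChain n k q A av) = 0 :=
  cycBnd_eq_zero_of_antisymmetric hn _ (zChain_permCell A av)

/-- A chain whose boundary vanishes on the lower matched cells is the sum of a boundary and a
combination of the chains `z_A`. -/
lemma exists_eq_cycBnd_add_sum (hn : 0 < n) (c : CycBas n (starIn n k) (q + 1) → ℚ)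
    (hc : ∀ (f : CycBas n (starIn n k) q) (h : CycBas n (starIn n k) (q + 1)),
      IsMatched (lab f) (lab h) → cycBnd n (starIn n k) q c f = 0)
    (av : CycBas n (starIn n k) (q + 1) → Fin q → Fin n)
    (hav : ∀ g, IsCritical g → ∀ t, lab g (av g t) = t + 1) :
    ∃ w, ∃ s ∈ Submodule.span ℚ {z | ∃ g : CycBas n (starIn n k) (q + 1), IsCritical g ∧
      z = zChain n k q (zeroSet g) (av g)}, c = cycBnd n (starIn n k) (q + 1) w + s := by
  classical
  obtain ⟨w, hw⟩ := exists_sub_matLin_eq_zero (cycMat n (starIn n k) (q + 1))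
    (fun f h => IsMatched (lab f) (lab h)) (fun f => rank (q + 1) (lab f))
    (fun f h hm => cycMat_ne_zero_of_isMatched hm)
    (fun f h f' h' hm hm' => rank_lt_rank_of_cycMat f h f' h' hm hm') c
  set c' := c - cycBnd n (starIn n k) (q + 1) w with hc'
  set s := ∑ g ∈ Finset.univ.filter (fun g : CycBas n (starIn n k) (q + 1) => IsCritical g),
    c' g • zChain n k q (zeroSet g) (av g) with hs
  refine ⟨w, s, Submodule.sum_mem _ fun g hg => Submodule.smul_mem _ _
    (Submodule.subset_span ⟨g, (Finset.mem_filter.mp hg).2, rfl⟩), ?_⟩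
  have hbs : cycBnd n (starIn n k) q s = 0 := by
    rw [hs, map_sum]
    exact Finset.sum_eq_zero fun g _ => by rw [map_smul, cycBnd_zChain hn, smul_zero]
  have h0 : c' - s = 0 := by
    refine eq_zero_of_matLin_eq_zero (cycMat n (starIn n k) q)
      (fun f h => IsMatched (lab f) (lab h)) (fun f => rank q (lab f))
      (fun f h hm => cycMat_ne_zero_of_isMatched hm)
      (fun f h f' h' hm hm' => rank_lt_rank_of_cycMat f h f' h' hm hm')
      (fun f g h hg hh => lab_injective (hg.unique hh)) _ ?_ ?_
    · intro f h hm
      change cycBnd n (starIn n k) q (c' - s) f = 0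
      rw [hc', map_sub, map_sub, hbs, cycBnd_cycBnd hn, sub_zero, sub_zero]
      exact hc f h hm
    · intro g hg
      by_contra hno
      refine hg ?_
      by_cases hcrit : IsCritical g
      · rw [Pi.sub_apply, hs, Finset.sum_apply, Finset.sum_eq_single g]
        · rw [Pi.smul_apply, zChain_of_isCritical hcrit (hav g hcrit) hcrit]
          simp
        · intro g' hg' hne
          have := (Finset.mem_filter.mp hg').2
          rw [Pi.smul_apply, zChain_of_isCritical this (hav g' this) hcrit, if_neg hne.symm,
            smul_zero]
        · intro h
          exact absurd (Finset.mem_filter.mpr ⟨Finset.mem_univ _, hcrit⟩) h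
      · obtain hf | ⟨h, hh⟩ := isMatched_or_isMatched_of_not_isCritical g hcrit
        · exact absurd hf hno
        · rw [Pi.sub_apply, hs, Finset.sum_apply, Finset.sum_eq_zero, sub_zero]
          · exact hw g h hh
          · intro g' hg'
            have := (Finset.mem_filter.mp hg').2
            rw [Pi.smul_apply, zChain_of_isMatched this (hav g' this) hh, smul_zero]
  rw [sub_eq_zero] at h0
  rw [← h0, hc']
  abel

end Critical

/-- Theorem (proof of paper Thm. `Vertex1Hypergraph`): for the `k`-uniform star hypergraph
`H` at the vertex `1` (`3 ≤ k ≤ n-1`) and `-1 ≤ r ≤ n-k-1` (below `q = r+1 ≤ n-k`), the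
elements `z_A`, for `A` ranging over the subsets of `{2, …, n}` with `n - r - 2 = n - q - 1`
elements, are cycles, and their homology classes form a basis of `HC_r(Δ(H))`.  The data
`av A` enumerates the complement of `A` in `{2, …, n}` increasingly. -/
theorem zChain_basis (n k : ℕ) (hk : 3 ≤ k) (hkn : k ≤ n - 1) (q : ℕ) (hq : q ≤ n - k)
    (av : Finset (Fin n) → Fin q → Fin n) (hmono : ∀ A, StrictMono (av A))
    (hrange : ∀ A : Finset (Fin n), (∀ x ∈ A, (x : ℕ) ≠ 0) → A.card = n - q - 1 →
      ∀ x : Fin n, (x ∉ A ∧ (x : ℕ) ≠ 0) ↔ x ∈ Set.range (av A)) :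
    ∃ hcyc : ∀ A : {A : Finset (Fin n) // (∀ x ∈ A, (x : ℕ) ≠ 0) ∧ A.card = n - q - 1},
        cycBnd n (starIn n k) q (zChain n k q A.1 (av A.1)) = 0,
      let fam : {A : Finset (Fin n) // (∀ x ∈ A, (x : ℕ) ≠ 0) ∧ A.card = n - q - 1} →
          homologyOf (cycBnd n (starIn n k) (q + 1)) (cycBnd n (starIn n k) q) :=
        fun A => Submodule.Quotient.mk
          ⟨zChain n k q A.1 (av A.1), LinearMap.mem_ker.mpr (hcyc A)⟩
      LinearIndependent ℚ fam ∧ Submodule.span ℚ (Set.range fam) = ⊤ := by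
  classical
  have hn : 0 < n := by omega
  refine ⟨fun A => cycBnd_zChain hn _ _, ?_⟩
  intro fam
  constructor
  · rw [Fintype.linearIndependent_iff]
    intro b hb A
    have hker : ∑ A, b A • fam A = Submodule.Quotient.mk (∑ A, b A •
        (⟨zChain n k q A.1 (av A.1), LinearMap.mem_ker.mpr (cycBnd_zChain hn _ _)⟩ :
          LinearMap.ker (cycBnd n (starIn n k) q))) := by
      rw [← Submodule.mkQ_apply, map_sum]
      rfl
    rw [hker, Submodule.Quotient.mk_eq_zero] at hb
    obtain ⟨w, hw⟩ := hb
    have hsum : cycBnd n (starIn n k) (q + 1) w = ∑ A, b A • zChain n k q A.1 (av A.1) := by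
      rw [hw]
      simp
    choose g hg hgA hgav using fun A : {A : Finset (Fin n) // (∀ x ∈ A, (x : ℕ) ≠ 0) ∧
        A.card = n - q - 1} => exists_isCritical (k := k) hn (by omega) (by omega) hq A.1 A.2.1
          A.2.2 (av A.1) (hmono A.1) (hrange A.1 A.2.1 A.2.2)
    have hzero : cycBnd n (starIn n k) (q + 1) w = 0 := by
      choose e he using exists_enumeration (n := n) (k := k) (q := q + 1)
      obtain ⟨w', s, hs, rfl⟩ := exists_eq_cycBnd_add_sum hn w (fun f h hm => by
        rw [hsum, Finset.sum_apply]
        refine Finset.sum_eq_zero fun A _ => ?_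
        rw [Pi.smul_apply]
        have := zChain_of_isMatched (hg A) (hgav A) hm
        rw [hgA A] at this
        rw [this, smul_zero]) e (fun g _ => he g)
      rw [map_add, cycBnd_cycBnd hn, zero_add]
      rw [← LinearMap.mem_ker]
      refine Submodule.span_le.mpr ?_ hs
      rintro z ⟨g, -, rfl⟩
      exact LinearMap.mem_ker.mpr (cycBnd_zChain hn _ _)
    rw [hzero] at hsum
    have hval := congrFun hsum (g A)
    rw [Finset.sum_apply, Finset.sum_eq_single A] at hval
    · have h1 := zChain_of_isCritical (hg A) (hgav A) (hg A)
      rw [hgA A, if_pos rfl] at h1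
      rw [Pi.smul_apply, h1] at hval
      simpa using hval.symm
    · intro A' _ hne
      have h1 := zChain_of_isCritical (hg A') (hgav A') (hg A)
      rw [hgA A', if_neg] at h1
      · rw [Pi.smul_apply, h1, smul_zero]
      · intro h
        exact hne (Subtype.ext (by rw [← hgA A, ← hgA A', h]))
    · simp
  · rw [eq_top_iff]
    rintro x -
    obtain ⟨⟨c, hc⟩, rfl⟩ := Submodule.Quotient.mk_surjective _ x
    have hcard : ∀ g : CycBas n (starIn n k) (q + 1), IsCritical g →
        (∀ x ∈ zeroSet g, (x : ℕ) ≠ 0) ∧ (zeroSet g).card = n - q - 1 :=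
      fun g hg => ⟨fun x hx => (mem_zeroSet.mp hx).2, hg.card_zeroSet hn⟩
    have hav : ∀ g : CycBas n (starIn n k) (q + 1), IsCritical g →
        ∀ t, lab g (av (zeroSet g) t) = t + 1 := by
      intro g hg
      obtain ⟨e, he⟩ := exists_enumeration g
      have : av (zeroSet g) = e := by
        refine ((hmono _).range_inj (hg.strictMono he)).mp (Set.ext fun x => ?_)
        rw [← hrange _ (hcard g hg).1 (hcard g hg).2, hg.mem_range_iff he]
        have := mem_zeroSet_or (g := g) (x := x)
        tauto
      rwa [this]
    obtain ⟨w, s, hs, hws⟩ := exists_eq_cycBnd_add_sum hn c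
      (fun f _ _ => congrFun (LinearMap.mem_ker.mp hc) f) (fun g => av (zeroSet g)) hav
    have hle : Submodule.span ℚ {z | ∃ g : CycBas n (starIn n k) (q + 1), IsCritical g ∧
        z = zChain n k q (zeroSet g) (av (zeroSet g))} ≤
        ((Submodule.span ℚ (Set.range fam)).comap (Submodule.mkQ _)).map
          (LinearMap.ker (cycBnd n (starIn n k) q)).subtype := by
      refine Submodule.span_le.mpr ?_
      rintro z ⟨g, hg, rfl⟩
      exact ⟨⟨_, LinearMap.mem_ker.mpr (cycBnd_zChain hn _ _)⟩,
        Submodule.subset_span ⟨⟨zeroSet g, hcard g hg⟩, rfl⟩, rfl⟩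
    obtain ⟨s', hs', rfl⟩ := hle hs
    have hmk : (Submodule.Quotient.mk ⟨c, hc⟩ :
        homologyOf (cycBnd n (starIn n k) (q + 1)) (cycBnd n (starIn n k) q)) =
          Submodule.Quotient.mk s' := by
      rw [Submodule.Quotient.eq]
      exact ⟨w, by simp [hws]⟩
    rw [hmk]
    exact hs'
end
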